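/- arXiv:1011.5484 — 4 statements merged into one kernel-verified Lean document; each statement's English description precedes it below -/
import Mathlib

section
/- Consider a commutative triangle of schemes f : X → Y, g : X → Z, h : Y → Z with h ∘ f = g, where f and g are quasi-compact, quasi-separated, surjective, and have geometrically connected fibers. If h is integral, then h is a universal homeomorphism. -/
open AlgebraicGeometry CategoryTheory Limits

/-- A morphism of schemes has geometrically connected fibers if for every
algebraically closed field `K` and every morphism `Spec K → Y`, the base change
`X ×_Y Spec K` is a connected (topological) space. -/
def HasGeomConnectedFibers {X Y : AlgebraicGeometry.Scheme}
    (f : X ⟶ Y) : Prop :=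
  ∀ (K : Type) (_ : Field K) (_ : IsAlgClosed K)
    (g : Spec (CommRingCat.of K) ⟶ Y), ConnectedSpace ↥(pullback f g)

/-- A universal homeomorphism of schemes: every base change of `f` is a
homeomorphism on underlying topological spaces. -/
def IsUniversalHomeomorphism : MorphismProperty AlgebraicGeometry.Scheme :=
  MorphismProperty.universally
    (fun (X Y : AlgebraicGeometry.Scheme) (f : X ⟶ Y) => IsHomeomorph f.base)

/-- Two algebra maps to `K` agree on an algebraic `K`-algebra with connected spectrum. -/
lemma RingHom.eq_of_isIntegral_of_preconnectedSpace {K A : Type*} [Field K] [CommRing A]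
    [PreconnectedSpace (PrimeSpectrum A)] {i : K →+* A} (hi : i.IsIntegral) {φ ψ : A →+* K}
    (hφ : φ.comp i = RingHom.id K) (hψ : ψ.comp i = RingHom.id K) : φ = ψ := by
  algebraize [i]
  ext a
  let B := Algebra.adjoin K {a}
  have : Module.Finite K B := ⟨(Submodule.fg_top _).mpr
    (IsIntegral.fg_adjoin_singleton (hi a))⟩
  have : IsArtinianRing B := IsArtinianRing.of_finite K B
  let c : PrimeSpectrum A → PrimeSpectrum B := PrimeSpectrum.comap B.val.toRingHom
  have hc : c ⟨RingHom.ker φ, RingHom.ker_isPrime φ⟩ = c ⟨RingHom.ker ψ, RingHom.ker_isPrime ψ⟩ :=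
    PreconnectedSpace.constant ‹_› (PrimeSpectrum.continuous_comap _)
  let b : B := ⟨a, Algebra.self_mem_adjoin_singleton K a⟩ - algebraMap K B (φ a)
  have hφ' (x : K) : φ (algebraMap K A x) = x := congr($hφ x)
  have hψ' (x : K) : ψ (algebraMap K A x) = x := congr($hψ x)
  have hb : b ∈ (c ⟨RingHom.ker φ, RingHom.ker_isPrime φ⟩).asIdeal := by
    change φ (a - algebraMap K A (φ a)) = 0
    rw [map_sub, hφ', sub_self]
  rw [hc] at hb
  replace hb : ψ (a - algebraMap K A (φ a)) = 0 := hb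
  rw [map_sub, hψ', sub_eq_zero] at hb
  exact hb.symm

namespace AlgebraicGeometry

universe u

/-- A connected scheme that is integral over a field `K` has at most one `K`-point. -/
lemma IsIntegralHom.section_unique {K : Type u} [Field K] {W : Scheme.{u}}
    [PreconnectedSpace W] (q : W ⟶ Spec (.of K)) [IsIntegralHom q] {s t : Spec (.of K) ⟶ W}
    (hs : s ≫ q = 𝟙 _) (ht : t ≫ q = 𝟙 _) : s = t := by
  wlog hW : ∃ A, W = Spec A generalizing W with hspec
  · have : IsAffine W := isAffine_of_isAffineHom q
    have : PreconnectedSpace (Spec Γ(W, ⊤)) :=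
      W.isoSpec.hom.surjective.denseRange.preconnectedSpace W.isoSpec.hom.continuous
    rw [← cancel_mono W.isoSpec.hom]
    exact hspec (W.isoSpec.inv ≫ q) (by simpa) (by simpa) ⟨_, rfl⟩
  obtain ⟨A, rfl⟩ := hW
  obtain ⟨i, rfl⟩ := Spec.map_surjective q
  obtain ⟨φ, rfl⟩ := Spec.map_surjective s
  obtain ⟨ψ, rfl⟩ := Spec.map_surjective t
  have : PreconnectedSpace (PrimeSpectrum A) := ‹_›
  rw [← Spec.map_comp, ← Spec.map_id] at hs ht
  congr 1
  ext1
  exact RingHom.eq_of_isIntegral_of_preconnectedSpace (IsIntegralHom.SpecMap_iff.mp ‹_›)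
    congr(($(Spec.map_injective hs)).hom) congr(($(Spec.map_injective ht)).hom)

/-- It suffices to test universal injectivity on points in algebraically closed fields. -/
lemma UniversallyInjective.of_isAlgClosed {Y Z : Scheme.{u}} (h : Y ⟶ Z)
    (H : ∀ (K : Type u) [Field K] [IsAlgClosed K] (s t : Spec (.of K) ⟶ Y),
      s ≫ h = t ≫ h → s = t) : UniversallyInjective h := by
  rw [UniversallyInjective.iff_diagonal, surjective_iff]
  intro z
  let k := (pullback h h).residueField z
  let φ : Spec (.of (AlgebraicClosure k)) ⟶ pullback h h :=
    Spec.map (CommRingCat.ofHom (algebraMap k (AlgebraicClosure k))) ≫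
      (pullback h h).fromSpecResidueField z
  have hφ : φ ≫ pullback.fst h h = φ ≫ pullback.snd h h :=
    H _ _ _ (by simp [pullback.condition])
  have hφ' : φ = (φ ≫ pullback.fst h h) ≫ pullback.diagonal h := by
    apply pullback.hom_ext <;> simp [hφ]
  let x : Spec (.of (AlgebraicClosure k)) := IsLocalRing.closedPoint _
  have hx : φ x = z := by
    rw [Scheme.Hom.comp_apply, Scheme.fromSpecResidueField_apply]
  exact ⟨(φ ≫ pullback.fst h h) x, (Scheme.Hom.comp_apply _ _ x).symm.trans (hφ' ▸ hx)⟩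

/-- Integral, universally injective and surjective morphisms are universal homeomorphisms. -/
lemma IsIntegralHom.isUniversalHomeomorphism {Y Z : Scheme.{u}} (h : Y ⟶ Z) [IsIntegralHom h]
    [UniversallyInjective h] [Surjective h] : IsUniversalHomeomorphism h := by
  intro Y' Z' i₁ i₂ h' sq
  have : IsIntegralHom h' := MorphismProperty.of_isPullback sq.flip ‹_›
  have : UniversallyInjective h' := MorphismProperty.of_isPullback sq.flip ‹_›
  have : Surjective h' := MorphismProperty.of_isPullback sq.flip ‹_›
  exact isHomeomorph_iff_continuous_isClosedMap_bijective.mpr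
    ⟨h'.continuous, h'.isClosedMap, h'.injective, h'.surjective⟩

end AlgebraicGeometry

lemma HasGeomConnectedFibers.universallyInjective_of_comp {X Y Z : Scheme.{0}} (f : X ⟶ Y)
    (h : Y ⟶ Z) [AlgebraicGeometry.Surjective f] [IsIntegralHom h]
    (H : HasGeomConnectedFibers (f ≫ h)) : UniversallyInjective h := by
  refine .of_isAlgClosed h fun K _ _ s t hst ↦ ?_
  have := H K _ ‹_› (s ≫ h)
  let π : pullback (f ≫ h) (s ≫ h) ⟶ pullback h (s ≫ h) :=
    (pullbackRightPullbackFstIso h (s ≫ h) f).inv ≫ pullback.snd f (pullback.fst h (s ≫ h))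
  have : PreconnectedSpace ↥(pullback h (s ≫ h)) :=
    π.surjective.denseRange.preconnectedSpace π.continuous
  have hs : s ≫ h = 𝟙 _ ≫ s ≫ h := (Category.id_comp _).symm
  have ht : t ≫ h = 𝟙 _ ≫ s ≫ h := hst.symm.trans hs
  rw [← pullback.lift_fst s (𝟙 _) hs, ← pullback.lift_fst t (𝟙 _) ht,
    IsIntegralHom.section_unique (pullback.snd h (s ≫ h))
      (pullback.lift_snd s (𝟙 _) hs) (pullback.lift_snd t (𝟙 _) ht)]

/-- Given a commutative triangle of schemes `h ∘ f = g` with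
`f : X → Y` and `g : X → Z` quasi-compact, quasi-separated, surjective, with
geometrically connected fibers, if `h : Y → Z` is integral then `h` is a
universal homeomorphism. -/
theorem isUniversalHomeomorphism_of_integral
    (X Y Z : AlgebraicGeometry.Scheme) (f : X ⟶ Y) (g : X ⟶ Z) (h : Y ⟶ Z)
    (hcomm : f ≫ h = g)
    [QuasiCompact f] [QuasiSeparated f] [AlgebraicGeometry.Surjective f]
    (hfc : HasGeomConnectedFibers f)
    [QuasiCompact g] [QuasiSeparated g] [AlgebraicGeometry.Surjective g]
    (hgc : HasGeomConnectedFibers g)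
    [IsIntegralHom h] :
    IsUniversalHomeomorphism h := by
  subst hcomm
  have := hgc.universallyInjective_of_comp
  have : AlgebraicGeometry.Surjective h := .of_comp f h
  exact IsIntegralHom.isUniversalHomeomorphism h
end

section
/- Let [A₁ ← A₃ → A₂] be a diagram of commutative rings with t₁ : A₁ → A₃ surjective. Let gᵢ : Aᵢ → Aᵢ' be flat ring maps (i = 1,2,3) with isomorphisms A₃' ≅ A₃ ⊗_{A₁} A₁' ≅ A₃ ⊗_{A₂} A₂'. Then the induced map g : A₁ ×_{A₃} A₂ → A₁' ×_{A₃'} A₂' is flat. -/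
section

variable (A1 A2 A3 A1' A2' A3' : Type*)
  [CommRing A1] [CommRing A2] [CommRing A3]
  [CommRing A1'] [CommRing A2'] [CommRing A3']
  [Algebra A1 A3] [Algebra A2 A3]
  [Algebra A1 A1'] [Algebra A2 A2'] [Algebra A3 A3']
  [Algebra A1' A3'] [Algebra A2' A3']
  [Algebra A1 A3'] [Algebra A2 A3']
  [IsScalarTower A1 A3 A3'] [IsScalarTower A1 A1' A3']
  [IsScalarTower A2 A3 A3'] [IsScalarTower A2 A2' A3']

/-- The fiber product ring `A₁ ×_{A₃} A₂` as a subring of `A₁ × A₂`. -/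
noncomputable def ringFiberProd : Subring (A1 × A2) :=
  RingHom.eqLocus ((algebraMap A1 A3).comp (RingHom.fst A1 A2))
    ((algebraMap A2 A3).comp (RingHom.snd A1 A2))

/-- The induced map `A₁ ×_{A₃} A₂ → A₁' ×_{A₃'} A₂'` on fiber products. -/
noncomputable def ringFiberProdMap :
    ringFiberProd A1 A2 A3 →+* ringFiberProd A1' A2' A3' :=
  RingHom.codRestrict
    (((algebraMap A1 A1').prodMap (algebraMap A2 A2')).comp
      (ringFiberProd A1 A2 A3).subtype)
    (ringFiberProd A1' A2' A3')
    (fun x => by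
      have hx : algebraMap A1 A3 (x : A1 × A2).1 = algebraMap A2 A3 (x : A1 × A2).2 := x.2
      show algebraMap A1' A3' (algebraMap A1 A1' (x : A1 × A2).1)
          = algebraMap A2' A3' (algebraMap A2 A2' (x : A1 × A2).2)
      rw [← IsScalarTower.algebraMap_apply A1 A1' A3',
        IsScalarTower.algebraMap_apply A1 A3 A3', hx,
        ← IsScalarTower.algebraMap_apply A2 A3 A3',
        IsScalarTower.algebraMap_apply A2 A2' A3'])

end

open TensorProduct

theorem rTensor_restrictScalars_injective_of_flat_baseChange {R A M N N' : Type*} [CommRing R]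
    [CommRing A] [Algebra R A] [AddCommGroup M] [Module R M] [Module.Flat A (A ⊗[R] M)]
    [AddCommGroup N] [Module R N] [Module A N] [IsScalarTower R A N]
    [AddCommGroup N'] [Module R N'] [Module A N'] [IsScalarTower R A N']
    (f : N →ₗ[A] N') (hf : Function.Injective f) :
    Function.Injective ((f.restrictScalars R).rTensor M) := by
  have h := Module.Flat.rTensor_preserves_injective_linearMap (M := A ⊗[R] M) f hf
  let e := AlgebraTensorModule.cancelBaseChange R A A N M
  let e' := AlgebraTensorModule.cancelBaseChange R A A N' M
  have comm (z : N ⊗[R] M) :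
      (f.restrictScalars R).rTensor M z = e' (f.rTensor (A ⊗[R] M) (e.symm z)) := by
    induction z with
    | zero => simp
    | tmul n m => simp [e, e']
    | add x y hx hy => rw [map_add, hx, hy, map_add, map_add, map_add]
  rw [show ⇑((f.restrictScalars R).rTensor M) =
    e' ∘ f.rTensor (A ⊗[R] M) ∘ e.symm from funext comm]
  exact e'.injective.comp (h.comp e.symm.injective)

theorem rTensor_injective_of_ker_smul_eq_zero {R A M N N' : Type*} [CommRing R]
    [CommRing A] [Algebra R A] [AddCommGroup M] [Module R M] [Module.Flat A (A ⊗[R] M)]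
    [AddCommGroup N] [Module R N] [AddCommGroup N'] [Module R N']
    (hA : Function.Surjective (algebraMap R A)) (f : N →ₗ[R] N') (hf : Function.Injective f)
    (hN' : ∀ a ∈ RingHom.ker (algebraMap R A), ∀ n : N', a • n = 0) :
    Function.Injective (f.rTensor M) := by
  let I := RingHom.ker (algebraMap R A)
  have tN' : Module.IsTorsionBySet R N' I := fun n a => hN' a a.2 n
  have tN : Module.IsTorsionBySet R N I := fun n a => hf <| by
    rw [map_smul, map_zero]; exact hN' a a.2 _
  let φ : A →+* R ⧸ I := (RingHom.quotientKerEquivOfSurjective hA).symm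
  have hφ (r : R) : φ (algebraMap R A r) = Ideal.Quotient.mk I r :=
    (RingEquiv.symm_apply_eq _).2 rfl
  let := tN.module
  let := tN'.module
  let : Module A N := Module.compHom N φ
  let : Module A N' := Module.compHom N' φ
  have sN (r : R) (n : N) : algebraMap R A r • n = r • n :=
    (congrArg (fun c : R ⧸ I => c • n) (hφ r)).trans rfl
  have sN' (r : R) (n : N') : algebraMap R A r • n = r • n :=
    (congrArg (fun c : R ⧸ I => c • n) (hφ r)).trans rfl
  have : IsScalarTower R A N := .of_algebraMap_smul sN
  have : IsScalarTower R A N' := .of_algebraMap_smul sN'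
  let g : N →ₗ[A] N' :=
    { f with
      map_smul' := fun a n => by
        obtain ⟨r, rfl⟩ := hA a
        simp [sN, sN'] }
  exact rTensor_restrictScalars_injective_of_flat_baseChange (A := A) (M := M) g hf

/-- If `0 → J ⊓ L → J → K ⧸ L` is exact with `K ⧸ L` a module over the quotient `A` of `R`, then
injectivity of `- ⊗ M → M` for `K` and `J ⊓ L` passes to `J`. -/
theorem Ideal.rTensor_subtype_injective_of_le {R A M : Type*} [CommRing R]
    [CommRing A] [Algebra R A] [AddCommGroup M] [Module R M] [Module.Flat A (A ⊗[R] M)]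
    (hA : Function.Surjective (algebraMap R A)) {J K L : Ideal R} (hJK : J ≤ K)
    (hKL : RingHom.ker (algebraMap R A) * K ≤ L)
    (hK : Function.Injective (K.subtype.rTensor M))
    (hJL : Function.Injective ((J ⊓ L).subtype.rTensor M)) :
    Function.Injective (J.subtype.rTensor M) := by
  let ι : J →ₗ[R] K := Submodule.inclusion hJK
  let LJ : Submodule R J := L.submoduleOf J
  let LK : Submodule R K := L.submoduleOf K
  let f : (J ⧸ LJ) →ₗ[R] K ⧸ LK := LJ.mapQ LK ι fun x hx => hx
  have hf : Function.Injective f := by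
    rw [injective_iff_map_eq_zero]
    intro x hx
    obtain ⟨x, rfl⟩ := LJ.mkQ_surjective x
    exact (Submodule.Quotient.mk_eq_zero LJ).2 ((Submodule.Quotient.mk_eq_zero LK).1 hx)
  have hfM : Function.Injective (f.rTensor M) := by
    refine rTensor_injective_of_ker_smul_eq_zero hA f hf fun a ha n => ?_
    obtain ⟨n, rfl⟩ := LK.mkQ_surjective n
    exact (Submodule.Quotient.mk_eq_zero LK).2 (hKL (Ideal.mul_mem_mul ha n.2))
  rw [injective_iff_map_eq_zero]
  intro z hz
  have hιz : ι.rTensor M z = 0 := by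
    apply hK
    rw [map_zero, ← LinearMap.comp_apply, ← LinearMap.rTensor_comp]
    exact hz
  have hqz : LJ.mkQ.rTensor M z = 0 := by
    apply hfM
    rw [map_zero, ← LinearMap.comp_apply, ← LinearMap.rTensor_comp,
      show f ∘ₗ LJ.mkQ = LK.mkQ ∘ₗ ι from rfl, LinearMap.rTensor_comp, LinearMap.comp_apply, hιz,
      map_zero]
  let κ : (J ⊓ L : Ideal R) →ₗ[R] J := Submodule.inclusion inf_le_left
  have hex : Function.Exact κ LJ.mkQ := by
    intro x
    constructor
    · intro hx
      exact ⟨⟨x, x.2, (Submodule.Quotient.mk_eq_zero LJ).1 hx⟩, rfl⟩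
    · rintro ⟨y, rfl⟩
      exact (Submodule.Quotient.mk_eq_zero LJ).2 y.2.2
  obtain ⟨w, rfl⟩ := (rTensor_exact M hex LJ.mkQ_surjective z).1 hqz
  have hw : w = 0 := by
    apply hJL
    rw [map_zero, ← hz, ← LinearMap.comp_apply, ← LinearMap.rTensor_comp]
    rfl
  rw [hw, map_zero]

theorem Ideal.rTensor_subtype_injective_of_mul_mem {R A M : Type*} [CommRing R]
    [CommRing A] [Algebra R A] [AddCommGroup M] [Module R M] [Module.Flat A (A ⊗[R] M)]
    (K : Ideal R) (hinj : Set.InjOn (algebraMap R A) K)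
    (hK : ∀ (a : A), ∀ k ∈ K, ∃ l ∈ K, algebraMap R A l = a * algebraMap R A k) :
    Function.Injective (K.subtype.rTensor M) := by
  let K' : Ideal A :=
    { carrier := algebraMap R A '' K
      add_mem' := by
        rintro _ _ ⟨x, hx, rfl⟩ ⟨y, hy, rfl⟩
        exact ⟨x + y, K.add_mem hx hy, map_add _ _ _⟩
      zero_mem' := ⟨0, K.zero_mem, map_zero _⟩
      smul_mem' := by
        rintro a _ ⟨x, hx, rfl⟩
        exact hK a x hx }
  let e₀ : K →ₗ[R] K' :=
    { toFun := fun k => ⟨algebraMap R A k, k, k.2, rfl⟩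
      map_add' := fun x y => Subtype.ext (map_add _ _ _)
      map_smul' := fun r x => Subtype.ext (by simp [Algebra.smul_def]) }
  let e : K ≃ₗ[R] K' := LinearEquiv.ofBijective e₀
    ⟨fun x y h => Subtype.ext (hinj x.2 y.2 (congrArg Subtype.val h)), by
      rintro ⟨_, x, hx, rfl⟩
      exact ⟨⟨x, hx⟩, rfl⟩⟩
  have h := (rTensor_restrictScalars_injective_of_flat_baseChange (R := R) (M := M) K'.subtype
    K'.injective_subtype).comp (e.rTensor M).injective
  have hcomp : (K'.subtype.restrictScalars R).rTensor M ∘ₗ (e.rTensor M).toLinearMap =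
      (Algebra.linearMap R A).rTensor M ∘ₗ K.subtype.rTensor M := by
    ext k m
    rfl
  refine Function.Injective.of_comp (f := (Algebra.linearMap R A).rTensor M) ?_
  rw [← LinearMap.coe_comp, ← hcomp]
  exact h

/-- Flatness over a ring `R` glued from `A₁` and a quotient `A₂` of `R`, where the kernel of
`R → A₂` is mapped bijectively to an ideal of `A₁`. -/
theorem Module.Flat.of_baseChange_of_conductor {R A₁ A₂ M : Type*} [CommRing R]
    [CommRing A₁] [CommRing A₂] [Algebra R A₁] [Algebra R A₂] [AddCommGroup M] [Module R M]
    [Module.Flat A₁ (A₁ ⊗[R] M)] [Module.Flat A₂ (A₂ ⊗[R] M)]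
    (h₂ : Function.Surjective (algebraMap R A₂))
    (hinj : Set.InjOn (algebraMap R A₁) (RingHom.ker (algebraMap R A₂)))
    (hcond : ∀ (a : A₁), ∀ i ∈ RingHom.ker (algebraMap R A₂),
      ∃ j ∈ RingHom.ker (algebraMap R A₂), algebraMap R A₁ j = a * algebraMap R A₁ i) :
    Module.Flat R M := by
  set I := RingHom.ker (algebraMap R A₂)
  have hle (J : Ideal R) (hJ : J ≤ I) : Function.Injective (J.subtype.rTensor M) := by
    have key : ∀ x ∈ J.map (algebraMap R A₁), ∀ i ∈ I,
        ∃ c ∈ I * J, algebraMap R A₁ c = algebraMap R A₁ i * x := by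
      intro x hx
      induction hx using Submodule.span_induction with
      | mem x hx =>
        obtain ⟨j, hj, rfl⟩ := hx
        exact fun i hi => ⟨i * j, Ideal.mul_mem_mul hi hj, map_mul _ _ _⟩
      | zero => exact fun i _ => ⟨0, zero_mem _, by simp⟩
      | add x y _ _ hx hy =>
        intro i hi
        obtain ⟨c, hc, hc'⟩ := hx i hi
        obtain ⟨d, hd, hd'⟩ := hy i hi
        exact ⟨c + d, add_mem hc hd, by rw [map_add, hc', hd', mul_add]⟩
      | smul a x _ hx =>
        intro i hi
        obtain ⟨i', hi', hai⟩ := hcond a i hi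
        obtain ⟨c, hc, hc'⟩ := hx i' hi'
        exact ⟨c, hc, by rw [hc', hai, smul_eq_mul]; ring⟩
    let K : Ideal R := I ⊓ (J.map (algebraMap R A₁)).comap (algebraMap R A₁)
    have hJK : J ≤ K := le_inf hJ Ideal.le_comap_map
    have hIK : I * K ≤ I * J := by
      rw [Ideal.mul_le]
      intro i hi k hk
      obtain ⟨c, hc, hc'⟩ := key _ hk.2 i hi
      rw [← map_mul] at hc'
      have hcI : c ∈ I := Ideal.mul_le_left hc
      have hikI : i * k ∈ I := I.mul_mem_right k hi
      have hcik : c = i * k := hinj hcI hikI hc'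
      exact hcik ▸ hc
    refine Ideal.rTensor_subtype_injective_of_le h₂ hJK hIK ?_ ?_
    · refine Ideal.rTensor_subtype_injective_of_mul_mem K (hinj.mono fun _ h => h.1) ?_
      intro a k hk
      obtain ⟨j, hj, hj'⟩ := hcond a k hk.1
      refine ⟨j, ⟨hj, ?_⟩, hj'⟩
      change algebraMap R A₁ j ∈ J.map (algebraMap R A₁)
      rw [hj']
      exact Ideal.mul_mem_left _ a hk.2
    · rw [inf_eq_right.2 Ideal.mul_le_right]
      refine Ideal.rTensor_subtype_injective_of_mul_mem (I * J)
        (hinj.mono fun _ h => Ideal.mul_le_left h) ?_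
      intro a k hk
      induction hk using Submodule.mul_induction_on' with
      | mem_mul_mem i hi j hj =>
        obtain ⟨i', hi', h'⟩ := hcond a i hi
        exact ⟨i' * j, Ideal.mul_mem_mul hi' hj, by rw [map_mul, map_mul, h', mul_assoc]⟩
      | add x _ y _ hx hy =>
        obtain ⟨c, hc, hc'⟩ := hx
        obtain ⟨d, hd, hd'⟩ := hy
        exact ⟨c + d, add_mem hc hd, by rw [map_add, hc', hd', map_add, mul_add]⟩
  rw [Module.Flat.iff_rTensor_injective']
  intro J
  refine Ideal.rTensor_subtype_injective_of_le (K := ⊤) (L := I) h₂ le_top Ideal.mul_le_left ?_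
    (hle _ inf_le_right)
  exact ((Submodule.topEquiv (R := R) (M := R)).rTensor M).injective

theorem TensorProduct.exists_eq_one_tmul_of_surjective {R A M : Type*} [CommRing R] [CommRing A]
    [Algebra R A] [AddCommGroup M] [Module R M] (hA : Function.Surjective (algebraMap R A))
    (z : A ⊗[R] M) : ∃ m : M, z = 1 ⊗ₜ m := by
  obtain ⟨m, hm⟩ := TensorProduct.mk_surjective R M A hA z
  exact ⟨m, hm.symm⟩

theorem mem_ker_smul_top_of_one_tmul_eq_zero {R A M : Type*} [CommRing R] [CommRing A]
    [Algebra R A] [AddCommGroup M] [Module R M] (hA : Function.Surjective (algebraMap R A))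
    {m : M} (hm : (1 : A) ⊗ₜ[R] m = 0) :
    m ∈ RingHom.ker (algebraMap R A) • (⊤ : Submodule R M) := by
  set I := RingHom.ker (algebraMap R A)
  have hex : Function.Exact I.subtype (Algebra.linearMap R A) := by
    intro x
    simp [I]
  obtain ⟨w, hw⟩ := (rTensor_exact M hex hA ((1 : R) ⊗ₜ[R] m)).1 (by simpa using hm)
  have hmem (w : I ⊗[R] M) : TensorProduct.lid R M (I.subtype.rTensor M w) ∈
      I • (⊤ : Submodule R M) := by
    induction w with
    | zero => simp
    | tmul i n => simpa using Submodule.smul_mem_smul i.2 (Submodule.mem_top (x := n))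
    | add x y hx hy => rw [map_add, map_add]; exact add_mem hx hy
  simpa [hw] using hmem w

theorem IsBaseChange.mem_ker_smul_top {A B N N' : Type*} [CommRing A] [CommRing B] [Algebra A B]
    [AddCommGroup N] [Module A N] [AddCommGroup N'] [Module A N'] [Module B N']
    [IsScalarTower A B N'] {q : N →ₗ[A] N'} (hq : IsBaseChange B q)
    (hB : Function.Surjective (algebraMap A B)) {x : N} (hx : q x = 0) :
    x ∈ RingHom.ker (algebraMap A B) • (⊤ : Submodule A N) := by
  refine mem_ker_smul_top_of_one_tmul_eq_zero hB (hq.equiv.injective ?_)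
  simpa using hx

theorem IsBaseChange.surjective {A B N N' : Type*} [CommRing A] [CommRing B] [Algebra A B]
    [AddCommGroup N] [Module A N] [AddCommGroup N'] [Module A N'] [Module B N']
    [IsScalarTower A B N'] {q : N →ₗ[A] N'} (hq : IsBaseChange B q)
    (hB : Function.Surjective (algebraMap A B)) : Function.Surjective q := by
  intro y
  obtain ⟨x, hx⟩ := TensorProduct.exists_eq_one_tmul_of_surjective hB (hq.equiv.symm y)
  refine ⟨x, ?_⟩
  rw [LinearEquiv.symm_apply_eq] at hx
  simpa using hx.symm

theorem LinearMap.isBaseChange_of_bijective_liftBaseChange {A B N N' : Type*} [CommRing A]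
    [CommRing B] [Algebra A B] [AddCommGroup N] [Module A N] [AddCommGroup N'] [Module A N']
    [Module B N'] [IsScalarTower A B N'] (q : N →ₗ[A] N')
    (h : Function.Bijective (q.liftBaseChange B)) : IsBaseChange B q :=
  .of_equiv (LinearEquiv.ofBijective _ h) fun x => by simp

theorem span_range_eq_top_of_fiberProduct {A₁ A₂ A₃ M M₁ M₂ M₃ : Type*}
    [CommRing A₁] [CommRing A₂] [CommRing A₃] [Algebra A₁ A₃] [Algebra A₂ A₃]
    [AddCommGroup M₁] [Module A₁ M₁] [AddCommGroup M₂] [Module A₂ M₂]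
    [AddCommGroup M₃] [Module A₁ M₃] [Module A₂ M₃] [Module A₃ M₃]
    [IsScalarTower A₁ A₃ M₃] [IsScalarTower A₂ A₃ M₃]
    {p₁ : M → M₁} {p₂ : M → M₂} {q₁ : M₁ →ₗ[A₁] M₃} {q₂ : M₂ →ₗ[A₂] M₃}
    (h₁₃ : Function.Surjective (algebraMap A₁ A₃)) (hq₂ : IsBaseChange A₃ q₂)
    (hex : ∀ x y, q₁ x = q₂ y → ∃ m, p₁ m = x ∧ p₂ m = y)
    (hq₁s : Function.Surjective q₁) : Submodule.span A₁ (Set.range p₁) = ⊤ := by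
  have hlift (t : M₃) : ∃ u ∈ Submodule.span A₁ (Set.range p₁), q₁ u = t := by
    induction t using hq₂.inductionOn with
    | zero => exact ⟨0, zero_mem _, map_zero _⟩
    | tmul y =>
      obtain ⟨x, hx⟩ := hq₁s (q₂ y)
      obtain ⟨m, rfl, rfl⟩ := hex x y hx
      exact ⟨p₁ m, Submodule.subset_span ⟨m, rfl⟩, hx⟩
    | smul s t ht =>
      obtain ⟨u, hu, rfl⟩ := ht
      obtain ⟨a, rfl⟩ := h₁₃ s
      exact ⟨a • u, Submodule.smul_mem _ a hu, by rw [map_smul, algebraMap_smul]⟩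
    | add s t hs ht =>
      obtain ⟨u, hu, rfl⟩ := hs
      obtain ⟨v, hv, rfl⟩ := ht
      exact ⟨u + v, add_mem hu hv, map_add _ _ _⟩
  rw [eq_top_iff]
  intro x _
  obtain ⟨u, hu, hux⟩ := hlift (q₁ x)
  obtain ⟨m, hm, -⟩ := hex (x - u) 0 (by rw [map_sub, hux, sub_self, map_zero])
  rw [← sub_add_cancel x u, ← hm]
  exact add_mem (Submodule.subset_span ⟨m, rfl⟩) hu

section FiberProduct

variable {R A₁ A₂ A₃ M M₁ M₂ M₃ : Type*} [CommRing R] [CommRing A₁] [CommRing A₂] [CommRing A₃]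
  [Algebra R A₁] [Algebra R A₂] [Algebra A₁ A₃] [Algebra A₂ A₃]
  [AddCommGroup M] [Module R M]
  [AddCommGroup M₁] [Module R M₁] [Module A₁ M₁] [IsScalarTower R A₁ M₁]
  [AddCommGroup M₂] [Module R M₂] [Module A₂ M₂] [IsScalarTower R A₂ M₂]
  [AddCommGroup M₃] [Module A₁ M₃] [Module A₂ M₃] [Module A₃ M₃]
  [IsScalarTower A₁ A₃ M₃] [IsScalarTower A₂ A₃ M₃]
  {p₁ : M →ₗ[R] M₁} {p₂ : M →ₗ[R] M₂} {q₁ : M₁ →ₗ[A₁] M₃} {q₂ : M₂ →ₗ[A₂] M₃}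

theorem mem_ker_smul_top_of_fiberProduct (h₁₃ : Function.Surjective (algebraMap A₁ A₃))
    (hRex : ∀ a, algebraMap A₁ A₃ a = 0 → ∃ r, algebraMap R A₁ r = a ∧ algebraMap R A₂ r = 0)
    (hq₁ : IsBaseChange A₃ q₁) (hq₂ : IsBaseChange A₃ q₂) (hcomm : ∀ m, q₁ (p₁ m) = q₂ (p₂ m))
    (hex : ∀ x y, q₁ x = q₂ y → ∃ m, p₁ m = x ∧ p₂ m = y)
    (hinj : ∀ m, p₁ m = 0 → p₂ m = 0 → m = 0) (hq₁s : Function.Surjective q₁)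
    {m : M} (hm : p₂ m = 0) :
    m ∈ RingHom.ker (algebraMap R A₂) • (⊤ : Submodule R M) := by
  set I := RingHom.ker (algebraMap R A₂)
  have hspan := span_range_eq_top_of_fiberProduct h₁₃ hq₂ hex hq₁s
  have hsmul (x : M₁) : ∀ a ∈ RingHom.ker (algebraMap A₁ A₃),
      ∃ n ∈ I • (⊤ : Submodule R M), p₁ n = a • x := by
    have hx : x ∈ Submodule.span A₁ (Set.range p₁) := hspan ▸ Submodule.mem_top
    induction hx using Submodule.span_induction with
    | mem x hx =>
      obtain ⟨n, rfl⟩ := hx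
      intro a ha
      obtain ⟨r, rfl, hr⟩ := hRex a ha
      exact ⟨r • n, Submodule.smul_mem_smul hr Submodule.mem_top,
        by rw [map_smul, algebraMap_smul]⟩
    | zero => exact fun a _ => ⟨0, zero_mem _, by simp⟩
    | add x y _ _ hx hy =>
      intro a ha
      obtain ⟨u, hu, hu'⟩ := hx a ha
      obtain ⟨v, hv, hv'⟩ := hy a ha
      exact ⟨u + v, add_mem hu hv, by rw [map_add, hu', hv', smul_add]⟩
    | smul c x _ hx =>
      intro a ha
      obtain ⟨u, hu, hu'⟩ := hx (a * c) (Ideal.mul_mem_right _ _ ha)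
      exact ⟨u, hu, by rw [hu', mul_smul]⟩
  have hlift (x : M₁) (hx : x ∈ RingHom.ker (algebraMap A₁ A₃) • (⊤ : Submodule A₁ M₁)) :
      ∃ n ∈ I • (⊤ : Submodule R M), p₁ n = x := by
    induction hx using Submodule.smul_induction_on' with
    | smul a ha x _ => exact hsmul x a ha
    | add x _ y _ hx hy =>
      obtain ⟨u, hu, rfl⟩ := hx
      obtain ⟨v, hv, rfl⟩ := hy
      exact ⟨u + v, add_mem hu hv, map_add _ _ _⟩
  obtain ⟨n, hn, hnm⟩ := hlift (p₁ m)
    (hq₁.mem_ker_smul_top h₁₃ (by rw [hcomm, hm, map_zero]))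
  have hn₂ : p₂ n = 0 := by
    have : I • (⊤ : Submodule R M) ≤ LinearMap.ker p₂ := by
      rw [Submodule.smul_le]
      intro i hi x _
      rw [LinearMap.mem_ker, map_smul, ← algebraMap_smul A₂ i, show algebraMap R A₂ i = 0 from hi,
        zero_smul]
    exact this hn
  have : n - m = 0 := hinj _ (by rw [map_sub, hnm, sub_self]) (by rw [map_sub, hn₂, hm, sub_self])
  rwa [← sub_eq_zero.1 this]

/-- Second projection of a fiber product of modules. -/
theorem isBaseChange_snd_of_fiberProduct (h₁₃ : Function.Surjective (algebraMap A₁ A₃))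
    (hR₂ : Function.Surjective (algebraMap R A₂))
    (hRex : ∀ a, algebraMap A₁ A₃ a = 0 → ∃ r, algebraMap R A₁ r = a ∧ algebraMap R A₂ r = 0)
    (hq₁ : IsBaseChange A₃ q₁) (hq₂ : IsBaseChange A₃ q₂) (hcomm : ∀ m, q₁ (p₁ m) = q₂ (p₂ m))
    (hex : ∀ x y, q₁ x = q₂ y → ∃ m, p₁ m = x ∧ p₂ m = y)
    (hinj : ∀ m, p₁ m = 0 → p₂ m = 0 → m = 0) : IsBaseChange A₂ p₂ := by
  have hq₁s := hq₁.surjective h₁₃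
  refine p₂.isBaseChange_of_bijective_liftBaseChange ⟨?_, ?_⟩
  · rw [injective_iff_map_eq_zero]
    intro z hz
    obtain ⟨m, rfl⟩ := TensorProduct.exists_eq_one_tmul_of_surjective hR₂ z
    have hm := mem_ker_smul_top_of_fiberProduct h₁₃ hRex hq₁ hq₂ hcomm hex hinj hq₁s
      (m := m) (by simpa using hz)
    have : RingHom.ker (algebraMap R A₂) • (⊤ : Submodule R M) ≤
        LinearMap.ker (TensorProduct.mk R A₂ M 1) := by
      rw [Submodule.smul_le]
      intro i hi x _
      rw [LinearMap.mem_ker, map_smul, TensorProduct.mk_apply, TensorProduct.smul_tmul',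
        Algebra.smul_def, show algebraMap R A₂ i = 0 from hi, zero_mul, TensorProduct.zero_tmul]
    exact this hm
  · intro y
    obtain ⟨x, hx⟩ := hq₁s (q₂ y)
    obtain ⟨m, -, hm⟩ := hex x y hx
    exact ⟨1 ⊗ₜ m, by simpa using hm⟩

variable [Algebra R A₃] [IsScalarTower R A₁ A₃] [IsScalarTower R A₂ A₃] [Module R M₃]
  [IsScalarTower R A₂ M₃] [IsScalarTower R A₃ M₃]

/-- First projection of a fiber product of modules. -/
theorem isBaseChange_fst_of_fiberProduct (h₁₃ : Function.Surjective (algebraMap A₁ A₃))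
    (hR₂ : Function.Surjective (algebraMap R A₂))
    (hRex : ∀ a, algebraMap A₁ A₃ a = 0 → ∃ r, algebraMap R A₁ r = a ∧ algebraMap R A₂ r = 0)
    (hq₁ : IsBaseChange A₃ q₁) (hq₂ : IsBaseChange A₃ q₂) (hcomm : ∀ m, q₁ (p₁ m) = q₂ (p₂ m))
    (hex : ∀ x y, q₁ x = q₂ y → ∃ m, p₁ m = x ∧ p₂ m = y)
    (hinj : ∀ m, p₁ m = 0 → p₂ m = 0 → m = 0) : IsBaseChange A₁ p₁ := by
  have hspan := span_range_eq_top_of_fiberProduct h₁₃ hq₂ hex (hq₁.surjective h₁₃)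
  have hp₂ := isBaseChange_snd_of_fiberProduct h₁₃ hR₂ hRex hq₁ hq₂ hcomm hex hinj
  refine p₁.isBaseChange_of_bijective_liftBaseChange ⟨?_, ?_⟩
  · rw [injective_iff_map_eq_zero]
    intro z hz
    let τ : A₁ →ₗ[R] A₃ := (IsScalarTower.toAlgHom R A₁ A₃).toLinearMap
    have hτz : τ.rTensor M z = 0 := by
      apply (hp₂.comp hq₂).equiv.injective
      rw [map_zero, ← map_zero q₁, ← hz]
      clear hz
      induction z with
      | zero => simp
      | tmul a m => simp [τ, hcomm]
      | add x y hx hy => rw [map_add, map_add, hx, hy, map_add, map_add]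
    have hexact : Function.Exact (LinearMap.ker τ).subtype τ := LinearMap.exact_subtype_ker_map τ
    obtain ⟨w, rfl⟩ := (rTensor_exact M hexact h₁₃ z).1 hτz
    have hw (w : LinearMap.ker τ ⊗[R] M) :
        ∃ m, p₂ m = 0 ∧ (LinearMap.ker τ).subtype.rTensor M w = 1 ⊗ₜ m := by
      induction w with
      | zero => exact ⟨0, map_zero _, by simp⟩
      | tmul a m =>
        obtain ⟨r, hr, hr'⟩ := hRex a a.2
        refine ⟨r • m, ?_, ?_⟩
        · rw [map_smul, ← algebraMap_smul A₂ r, hr', zero_smul]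
        · rw [LinearMap.rTensor_tmul, Submodule.subtype_apply, ← hr, ← TensorProduct.smul_tmul,
            Algebra.smul_def, mul_one]
      | add x y hx hy =>
        obtain ⟨u, hu, hu'⟩ := hx
        obtain ⟨v, hv, hv'⟩ := hy
        exact ⟨u + v, by rw [map_add, hu, hv, add_zero],
          by rw [map_add, hu', hv', TensorProduct.tmul_add]⟩
    obtain ⟨m, hm, hm'⟩ := hw w
    rw [hm'] at hz ⊢
    rw [hinj m (by simpa using hz) hm, TensorProduct.tmul_zero]
  · rw [← LinearMap.range_eq_top, eq_top_iff, ← hspan, Submodule.span_le]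
    rintro _ ⟨m, rfl⟩
    exact ⟨1 ⊗ₜ m, by simp⟩

/-- A fiber product of flat modules along a surjection of rings, compatible with base change, is
flat over the fiber product of the rings. -/
theorem Module.Flat.of_fiberProduct [Module.Flat A₁ M₁] [Module.Flat A₂ M₂]
    (h₁₃ : Function.Surjective (algebraMap A₁ A₃))
    (hRex : ∀ a b, algebraMap A₁ A₃ a = algebraMap A₂ A₃ b →
      ∃ r, algebraMap R A₁ r = a ∧ algebraMap R A₂ r = b)
    (hRinj : ∀ r, algebraMap R A₁ r = 0 → algebraMap R A₂ r = 0 → r = 0)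
    (hq₁ : IsBaseChange A₃ q₁) (hq₂ : IsBaseChange A₃ q₂) (hcomm : ∀ m, q₁ (p₁ m) = q₂ (p₂ m))
    (hex : ∀ x y, q₁ x = q₂ y → ∃ m, p₁ m = x ∧ p₂ m = y)
    (hinj : ∀ m, p₁ m = 0 → p₂ m = 0 → m = 0) : Module.Flat R M := by
  have hR₂ : Function.Surjective (algebraMap R A₂) := fun b => by
    obtain ⟨a, ha⟩ := h₁₃ (algebraMap A₂ A₃ b)
    obtain ⟨r, -, hr⟩ := hRex a b ha
    exact ⟨r, hr⟩
  have hRex₀ (a : A₁) (ha : algebraMap A₁ A₃ a = 0) :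
      ∃ r, algebraMap R A₁ r = a ∧ algebraMap R A₂ r = 0 :=
    hRex a 0 (by rw [ha, map_zero])
  have hp₁ := isBaseChange_fst_of_fiberProduct h₁₃ hR₂ hRex₀ hq₁ hq₂ hcomm hex hinj
  have hp₂ := isBaseChange_snd_of_fiberProduct h₁₃ hR₂ hRex₀ hq₁ hq₂ hcomm hex hinj
  have : Module.Flat A₁ (A₁ ⊗[R] M) := .of_linearEquiv hp₁.equiv
  have : Module.Flat A₂ (A₂ ⊗[R] M) := .of_linearEquiv hp₂.equiv
  refine Module.Flat.of_baseChange_of_conductor (A₁ := A₁) (A₂ := A₂) hR₂ ?_ ?_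
  · intro x hx y hy hxy
    refine sub_eq_zero.1 (hRinj _ (by rw [map_sub, hxy, sub_self]) ?_)
    rw [map_sub, show algebraMap R A₂ x = 0 from hx, show algebraMap R A₂ y = 0 from hy, sub_self]
  · intro a i hi
    obtain ⟨r, hr, hr'⟩ := hRex₀ (a * algebraMap R A₁ i) (by
      rw [map_mul, ← IsScalarTower.algebraMap_apply, IsScalarTower.algebraMap_apply R A₂ A₃,
        show algebraMap R A₂ i = 0 from hi, map_zero, mul_zero])
    exact ⟨r, hr', hr⟩

end FiberProduct

section

variable (A1 A2 A3 A1' A2' A3' : Type*)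
  [CommRing A1] [CommRing A2] [CommRing A3]
  [CommRing A1'] [CommRing A2'] [CommRing A3']
  [Algebra A1 A3] [Algebra A2 A3]
  [Algebra A1 A1'] [Algebra A2 A2'] [Algebra A3 A3']
  [Algebra A1' A3'] [Algebra A2' A3']
  [Algebra A1 A3'] [Algebra A2 A3']
  [IsScalarTower A1 A3 A3'] [IsScalarTower A1 A1' A3']
  [IsScalarTower A2 A3 A3'] [IsScalarTower A2 A2' A3']

/-- Let `[A₁ ← A₃ → A₂]` be a diagram of commutative rings with
`t₁ : A₁ → A₃` surjective. Given flat ring maps `gᵢ : Aᵢ → Aᵢ'` compatible with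
base-change isomorphisms `A₃' ≅ A₃ ⊗_{A₁} A₁' ≅ A₃ ⊗_{A₂} A₂'` (expressed as
pushout squares), the induced map `A₁ ×_{A₃} A₂ → A₁' ×_{A₃'} A₂'` is flat. -/
theorem ringFiberProdMap_flat
    (ht₁ : Function.Surjective (algebraMap A1 A3))
    [Module.Flat A1 A1'] [Module.Flat A2 A2'] [Module.Flat A3 A3']
    [Algebra.IsPushout A1 A3 A1' A3'] [Algebra.IsPushout A2 A3 A2' A3'] :
    letI : Algebra (ringFiberProd A1 A2 A3) (ringFiberProd A1' A2' A3') :=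
      (ringFiberProdMap A1 A2 A3 A1' A2' A3').toAlgebra
    Module.Flat (ringFiberProd A1 A2 A3) (ringFiberProd A1' A2' A3') := by
  let S := ringFiberProd A1 A2 A3
  let S' := ringFiberProd A1' A2' A3'
  let : Algebra S S' := (ringFiberProdMap A1 A2 A3 A1' A2' A3').toAlgebra
  let f₁ : S →+* A1 := (RingHom.fst A1 A2).comp S.subtype
  let f₂ : S →+* A2 := (RingHom.snd A1 A2).comp S.subtype
  let : Algebra S A1 := f₁.toAlgebra
  let : Algebra S A2 := f₂.toAlgebra
  let : Algebra S A3 := ((algebraMap A1 A3).comp f₁).toAlgebra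
  let : Algebra S A1' := ((algebraMap A1 A1').comp f₁).toAlgebra
  let : Algebra S A2' := ((algebraMap A2 A2').comp f₂).toAlgebra
  let : Algebra S A3' := ((algebraMap A1 A3').comp f₁).toAlgebra
  have : IsScalarTower S A1 A3 := .of_algebraMap_eq fun _ => rfl
  have : IsScalarTower S A2 A3 := .of_algebraMap_eq fun r => r.2
  have : IsScalarTower S A1 A1' := .of_algebraMap_eq fun _ => rfl
  have : IsScalarTower S A2 A2' := .of_algebraMap_eq fun _ => rfl
  have : IsScalarTower S A3 A3' := .of_algebraMap_eq fun _ =>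
    IsScalarTower.algebraMap_apply A1 A3 A3' _
  have : IsScalarTower S A2 A3' := .of_algebraMap_eq fun r => by
    rw [IsScalarTower.algebraMap_apply S A3 A3', IsScalarTower.algebraMap_apply S A2 A3,
      ← IsScalarTower.algebraMap_apply A2 A3 A3']
  let p₁ : S' →ₗ[S] A1' :=
    { toFun := fun x => (x : A1' × A2').1
      map_add' := fun _ _ => rfl
      map_smul' := fun r x => by rw [Algebra.smul_def, Algebra.smul_def]; rfl }
  let p₂ : S' →ₗ[S] A2' :=
    { toFun := fun x => (x : A1' × A2').2
      map_add' := fun _ _ => rfl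
      map_smul' := fun r x => by rw [Algebra.smul_def, Algebra.smul_def]; rfl }
  exact Module.Flat.of_fiberProduct (R := S) (p₁ := p₁) (p₂ := p₂) ht₁
    (fun a b h => ⟨⟨(a, b), h⟩, rfl, rfl⟩) (fun r h₁ h₂ => Subtype.ext (Prod.ext h₁ h₂))
    (Algebra.IsPushout.out : IsBaseChange A3 (IsScalarTower.toAlgHom A1 A1' A3').toLinearMap)
    (Algebra.IsPushout.out : IsBaseChange A3 (IsScalarTower.toAlgHom A2 A2' A3').toLinearMap)
    (fun m => m.2) (fun x y h => ⟨⟨(x, y), h⟩, rfl, rfl⟩)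
    (fun m h₁ h₂ => Subtype.ext (Prod.ext h₁ h₂))

end
end

section
/- Let [A₁ ← A₃ → A₂] be a diagram of commutative rings with A₁ → A₃ surjective, and let gᵢ : Aᵢ → Aᵢ' be flat, finitely presented ring maps (i = 1,2,3) with isomorphisms A₃' ≅ A₃ ⊗_{A₁} A₁' ≅ A₃ ⊗_{A₂} A₂'. Then the induced map A₁ ×_{A₃} A₂ → A₁' ×_{A₃'} A₂' is flat and finitely presented. -/
/-- Two algebras `B` and `C` over `A` form a *Milnor pair* if `A → C` is surjective and its kernel
is mapped bijectively onto an ideal of `B`. -/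
structure IsMilnorPair (A B C : Type*) [CommRing A] [CommRing B] [CommRing C]
    [Algebra A B] [Algebra A C] : Prop where
  surjective : Function.Surjective (algebraMap A C)
  eq_zero : ∀ i : A, algebraMap A C i = 0 → algebraMap A B i = 0 → i = 0
  exists_mul : ∀ i : A, algebraMap A C i = 0 → ∀ b : B,
    ∃ j : A, algebraMap A C j = 0 ∧ algebraMap A B j = b * algebraMap A B i

section MilnorPair

open TensorProduct

section

variable {A M : Type*} [CommRing A] [AddCommGroup M] [Module A M]

lemma Module.Flat.rTensor_restrictScalars_injective (B : Type*) [CommRing B] [Algebra A B]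
    [Module.Flat B (B ⊗[A] M)] {Y Z : Type*} [AddCommGroup Y] [AddCommGroup Z]
    [Module A Y] [Module B Y] [IsScalarTower A B Y]
    [Module A Z] [Module B Z] [IsScalarTower A B Z]
    (f : Y →ₗ[B] Z) (hf : Function.Injective f) :
    Function.Injective ((f.restrictScalars A).rTensor M) := by
  let eY := AlgebraTensorModule.cancelBaseChange A B B Y M
  let eZ := AlgebraTensorModule.cancelBaseChange A B B Z M
  have key : (f.restrictScalars A).rTensor M ∘ₗ eY.toLinearMap.restrictScalars A =
      (eZ.toLinearMap ∘ₗ f.rTensor (B ⊗[A] M)).restrictScalars A := by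
    apply LinearMap.ext
    intro x
    induction x with
    | zero => simp
    | add x y hx hy => rw [map_add, map_add, hx, hy]
    | tmul y t =>
      induction t with
      | zero => simp
      | add x z hx hz => rw [tmul_add, map_add, map_add, hx, hz]
      | tmul b m => simp [eY, eZ]
  have h : Function.Injective ((f.restrictScalars A).rTensor M ∘ eY) := by
    have h' : Function.Injective (eZ ∘ f.rTensor (B ⊗[A] M)) :=
      eZ.injective.comp (Module.Flat.rTensor_preserves_injective_linearMap f hf)
    convert h' using 1
    exact congrArg DFunLike.coe key
  exact (EquivLike.injective_comp eY _).mp h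

/-- Version of `Module.Flat.rTensor_restrictScalars_injective` for modules annihilated by
the kernel of a surjection `A → C`. -/
lemma Module.Flat.rTensor_injective_of_surjective (C : Type*) [CommRing C] [Algebra A C]
    [Module.Flat C (C ⊗[A] M)] (hC : Function.Surjective (algebraMap A C))
    {Y Z : Type*} [AddCommGroup Y] [AddCommGroup Z] [Module A Y] [Module A Z]
    (f : Y →ₗ[A] Z) (hf : Function.Injective f)
    (hZ : ∀ i : A, algebraMap A C i = 0 → ∀ z : Z, i • z = 0) :
    Function.Injective (f.rTensor M) := by
  have hY (i : A) (hi : algebraMap A C i = 0) (y : Y) : i • y = 0 :=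
    hf (by rw [map_smul, hZ i hi, map_zero])
  let s := Function.surjInv hC
  have hs (a : A) : algebraMap A C (s (algebraMap A C a) - a) = 0 := by
    rw [map_sub, Function.surjInv_eq hC, sub_self]
  let : SMul C Y := ⟨fun c y ↦ s c • y⟩
  let : SMul C Z := ⟨fun c z ↦ s c • z⟩
  have hsY (a : A) (y : Y) : algebraMap A C a • y = a • y := by
    have := hY _ (hs a) y
    rwa [sub_smul, sub_eq_zero] at this
  have hsZ (a : A) (z : Z) : algebraMap A C a • z = a • z := by
    have := hZ _ (hs a) z
    rwa [sub_smul, sub_eq_zero] at this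
  let : Module C Y := hC.moduleLeft (algebraMap A C) hsY
  let : Module C Z := hC.moduleLeft (algebraMap A C) hsZ
  have : IsScalarTower A C Y := .of_algebraMap_smul hsY
  have : IsScalarTower A C Z := .of_algebraMap_smul hsZ
  let g : Y →ₗ[C] Z := { f with map_smul' := fun c y ↦ f.map_smul (s c) y }
  exact Module.Flat.rTensor_restrictScalars_injective C g hf

lemma LinearMap.rTensor_injective_of_exact {K' K K'' X X'' : Type*}
    [AddCommGroup K'] [AddCommGroup K] [AddCommGroup K''] [AddCommGroup X] [AddCommGroup X'']
    [Module A K'] [Module A K] [Module A K''] [Module A X] [Module A X'']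
    {i : K' →ₗ[A] K} {q : K →ₗ[A] K''} (hiq : Function.Exact i q) (hq : Function.Surjective q)
    {f : K →ₗ[A] X} {p : X →ₗ[A] X''} {f'' : K'' →ₗ[A] X''} (hpf : p ∘ₗ f = f'' ∘ₗ q)
    (hi : Function.Injective ((f ∘ₗ i).rTensor M)) (hf'' : Function.Injective (f''.rTensor M)) :
    Function.Injective (f.rTensor M) := by
  rw [injective_iff_map_eq_zero]
  intro z hz
  have hqz : q.rTensor M z = 0 := by
    apply hf''
    rw [← LinearMap.rTensor_comp_apply, ← hpf, LinearMap.rTensor_comp_apply, hz, map_zero,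
      map_zero]
  obtain ⟨w, rfl⟩ := (rTensor_exact M hiq hq z).mp hqz
  rw [← LinearMap.rTensor_comp_apply] at hz
  rw [hi (hz.trans (map_zero _).symm), map_zero]

end

namespace IsMilnorPair

variable {A B C M : Type*} [CommRing A] [CommRing B] [CommRing C] [Algebra A B] [Algebra A C]
  [AddCommGroup M] [Module A M]

lemma rTensor_subtype_injective (h : IsMilnorPair A B C)
    [Module.Flat B (B ⊗[A] M)] [Module.Flat C (C ⊗[A] M)]
    {X : Type*} [AddCommGroup X] [Module A X] [Module B X] [IsScalarTower A B X]
    (K : Submodule A X) : Function.Injective (K.subtype.rTensor M) := by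
  let L : Submodule B X := .span B K
  let W : Submodule B X := .span B {x | ∃ i : A, algebraMap A C i = 0 ∧ ∃ k ∈ K, i • k = x}
  have hKL : K ≤ L.restrictScalars A := Submodule.subset_span
  have hWK : W.restrictScalars A ≤ K := by
    intro x hx
    induction hx using Submodule.closure_induction with
    | zero => exact K.zero_mem
    | add x y _ _ hx hy => exact K.add_mem hx hy
    | smul_mem b x hx =>
      obtain ⟨i, hi, k, hk, rfl⟩ := hx
      obtain ⟨j, -, hj⟩ := h.exists_mul i hi b
      rw [← algebraMap_smul B i k, smul_smul, ← hj, algebraMap_smul]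
      exact K.smul_mem j hk
  have hLW (i : A) (hi : algebraMap A C i = 0) (x : X) (hx : x ∈ L) : i • x ∈ W := by
    induction hx using Submodule.span_induction with
    | mem x hx => exact Submodule.subset_span ⟨i, hi, x, hx, rfl⟩
    | zero => simp
    | add x y _ _ hx hy => rw [smul_add]; exact W.add_mem hx hy
    | smul b x _ hx =>
      rw [← algebraMap_smul B, smul_comm, algebraMap_smul]
      exact W.smul_mem b hx
  let π : X →ₗ[A] X ⧸ W := W.mkQ.restrictScalars A
  let KW : Submodule A (X ⧸ W) := K.map π
  let LW : Submodule A (X ⧸ W) := (L.restrictScalars A).map π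
  have hKLW : KW ≤ LW := Submodule.map_mono hKL
  let q : K →ₗ[A] KW := π.submoduleMap K
  let p : L.restrictScalars A →ₗ[A] LW := π.submoduleMap (L.restrictScalars A)
  have hL : Function.Injective ((L.restrictScalars A).subtype.rTensor M) := by
    have := Module.Flat.rTensor_restrictScalars_injective (A := A) (M := M) B L.subtype
      L.injective_subtype
    exact this
  suffices H : Function.Injective ((Submodule.inclusion hKL).rTensor M) by
    rw [← Submodule.subtype_comp_inclusion _ _ hKL, LinearMap.rTensor_comp]
    exact hL.comp H
  refine LinearMap.rTensor_injective_of_exact (i := Submodule.inclusion hWK) (q := q) (p := p)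
    (f'' := Submodule.inclusion hKLW) ?_ (π.submoduleMap_surjective K) rfl ?_ ?_
  · intro x
    have : q x = 0 ↔ (x : X) ∈ W := by
      rw [← Submodule.Quotient.mk_eq_zero, ← Subtype.coe_inj]
      rfl
    rw [this]
    exact ⟨fun hx ↦ ⟨⟨x, hx⟩, rfl⟩, fun ⟨w, hw⟩ ↦ hw ▸ w.2⟩
  · have hWL : W ≤ L := fun x hx ↦ hKL (hWK hx)
    have := Module.Flat.rTensor_restrictScalars_injective (A := A) (M := M) B
      (Submodule.inclusion hWL) (Submodule.inclusion_injective hWL)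
    exact this
  · refine Module.Flat.rTensor_injective_of_surjective C h.surjective _
      (Submodule.inclusion_injective hKLW) ?_
    rintro i hi ⟨-, x, hx, rfl⟩
    exact Subtype.ext ((Submodule.Quotient.mk_eq_zero W).mpr (hLW i hi x hx))

lemma rTensor_injective (h : IsMilnorPair A B C)
    [Module.Flat B (B ⊗[A] M)] [Module.Flat C (C ⊗[A] M)]
    {K X : Type*} [AddCommGroup K] [Module A K]
    [AddCommGroup X] [Module A X] [Module B X] [IsScalarTower A B X]
    (f : K →ₗ[A] X) (hf : Function.Injective f) : Function.Injective (f.rTensor M) := by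
  have : f = (LinearMap.range f).subtype ∘ₗ (LinearEquiv.ofInjective f hf).toLinearMap := rfl
  rw [this, LinearMap.rTensor_comp]
  exact (h.rTensor_subtype_injective _).comp
    ((LinearEquiv.ofInjective f hf).rTensor M).injective

theorem flat (h : IsMilnorPair A B C)
    [Module.Flat B (B ⊗[A] M)] [Module.Flat C (C ⊗[A] M)] : Module.Flat A M := by
  rw [Module.Flat.iff_rTensor_injective']
  intro J
  let I : Ideal A := RingHom.ker (algebraMap A C)
  let p : A →ₗ[A] C := Algebra.linearMap A C
  refine LinearMap.rTensor_injective_of_exact (i := Submodule.inclusion (inf_le_left : J ⊓ I ≤ J))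
    (q := p.submoduleMap J) (p := p) (f'' := (Submodule.map p J).subtype) ?_
    (p.submoduleMap_surjective J) rfl ?_ ?_
  · intro x
    rw [← Subtype.coe_inj]
    exact ⟨fun hx ↦ ⟨⟨x, x.2, hx⟩, rfl⟩, fun ⟨w, hw⟩ ↦ hw ▸ w.2.2⟩
  · have H : Function.Injective
        ((Algebra.linearMap A B ∘ₗ (J ⊓ I).subtype).rTensor M) := by
      refine h.rTensor_injective _ ((injective_iff_map_eq_zero _).mpr fun x hx ↦ ?_)
      exact Subtype.ext (h.eq_zero x x.2.2 hx)
    rw [LinearMap.rTensor_comp, LinearMap.coe_comp] at H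
    exact H.of_comp
  · refine Module.Flat.rTensor_injective_of_surjective C h.surjective _
      (Submodule.injective_subtype _) fun i hi z ↦ ?_
    rw [Algebra.smul_def, hi, zero_mul]

end IsMilnorPair

lemma LinearMap.subsingleton_tensorProduct_quotient_range {A D M N : Type*} [CommRing A]
    [AddCommGroup D] [Module A D] [AddCommGroup M] [Module A M] [AddCommGroup N] [Module A N]
    (f : N →ₗ[A] M) (hf : Function.Surjective (f.lTensor D)) :
    Subsingleton (D ⊗[A] (M ⧸ LinearMap.range f)) := by
  have hex : Function.Exact (f.lTensor D) ((LinearMap.range f).mkQ.lTensor D) :=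
    lTensor_exact D (LinearMap.exact_map_mkQ_range f) (Submodule.mkQ_surjective _)
  refine subsingleton_of_forall_eq 0 fun t ↦ ?_
  obtain ⟨t, rfl⟩ := LinearMap.lTensor_surjective D
    (Submodule.mkQ_surjective (LinearMap.range f)) t
  exact (hex t).mpr (hf t)

namespace IsMilnorPair

variable {A B C M : Type*} [CommRing A] [CommRing B] [CommRing C] [Algebra A B] [Algebra A C]
  [AddCommGroup M] [Module A M]

variable (M) in
lemma subsingleton (h : IsMilnorPair A B C)
    [Subsingleton (B ⊗[A] M)] [Subsingleton (C ⊗[A] M)] : Subsingleton M := by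
  have hsmul (i : A) (hi : algebraMap A C i = 0) (m : M) : i • m = 0 := by
    choose j hjC hjB using h.exists_mul i hi
    have hj (a : A) (b : B) (ha : algebraMap A C a = 0) (hab : algebraMap A B a = b * algebraMap A B i) :
        j b = a := by
      rw [← sub_eq_zero]
      apply h.eq_zero
      · rw [map_sub, hjC, ha, sub_zero]
      · rw [map_sub, hjB, hab, sub_self]
    let φ : B →ₗ[A] A :=
      { toFun := j
        map_add' := fun b b' ↦ hj _ _ (by simp [hjC]) (by simp [hjB, add_mul])
        map_smul' := fun a b ↦ hj _ _ (by simp [hjC]) (by simp [hjB, Algebra.smul_def, mul_assoc]) }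
    have hφ : φ 1 = i := hj _ _ hi (one_mul _).symm
    have := congrArg (fun t ↦ TensorProduct.lid A M (φ.rTensor M t))
      (Subsingleton.elim ((1 : B) ⊗ₜ[A] m) 0)
    simpa [hφ] using this
  refine subsingleton_of_forall_eq 0 fun m ↦ ?_
  let K := RingHom.ker (algebraMap A C)
  have hex : Function.Exact (K.subtype.rTensor M) ((Algebra.linearMap A C).rTensor M) :=
    rTensor_exact M (fun x ↦ ⟨fun hx ↦ ⟨⟨x, hx⟩, rfl⟩, fun ⟨w, hw⟩ ↦ hw ▸ w.2⟩) h.surjective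
  obtain ⟨w, hw⟩ := (hex ((1 : A) ⊗ₜ m)).mp (Subsingleton.elim _ _)
  have hw0 : ∀ w, TensorProduct.lid A M (K.subtype.rTensor M w) = 0 := by
    intro w
    induction w with
    | zero => simp
    | add x y hx hy => rw [map_add, map_add, hx, hy, add_zero]
    | tmul i m => simpa using hsmul i i.2 m
  simpa [hw] using hw0 w

lemma surjective_of_lTensor (h : IsMilnorPair A B C) {N : Type*} [AddCommGroup N] [Module A N]
    (f : N →ₗ[A] M) (hB : Function.Surjective (f.lTensor B))
    (hC : Function.Surjective (f.lTensor C)) : Function.Surjective f := by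
  have := f.subsingleton_tensorProduct_quotient_range hB
  have := f.subsingleton_tensorProduct_quotient_range hC
  have := h.subsingleton (M ⧸ LinearMap.range f)
  rw [← LinearMap.range_eq_top]
  exact Submodule.Quotient.subsingleton_iff.mp this

end IsMilnorPair

lemma Ideal.exists_finset_map_includeRight_le {A D P : Type*} [CommRing A] [CommRing D]
    [CommRing P] [Algebra A D] [Algebra A P] (Q : Ideal P)
    (hQ : (Q.map (Algebra.TensorProduct.includeRight : P →ₐ[A] D ⊗[A] P)).FG) :
    ∃ T : Finset P, (T : Set P) ⊆ Q ∧
      Q.map (Algebra.TensorProduct.includeRight : P →ₐ[A] D ⊗[A] P) ≤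
        (Ideal.span (T : Set P)).map (Algebra.TensorProduct.includeRight : P →ₐ[A] D ⊗[A] P) := by
  classical
  obtain ⟨s, hs, hsQ⟩ := (Submodule.fg_span_iff_fg_span_finset_subset _).mp hQ
  obtain ⟨T, hT, rfl⟩ := Finset.subset_set_image_iff.mp hs
  refine ⟨T, hT, ?_⟩
  rw [Ideal.map_span, ← Finset.coe_image]
  exact hsQ.le

lemma Algebra.FiniteType.exists_finset_adjoin {A D S : Type*} [CommRing A] [CommRing D]
    [CommRing S] [Algebra A D] [Algebra A S] [Algebra.FiniteType D (D ⊗[A] S)] :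
    ∃ T : Finset S, ∀ T' : Set S, (T : Set S) ⊆ T' →
      Function.Surjective ((Algebra.adjoin A T').val.toLinearMap.lTensor D) := by
  classical
  obtain ⟨s, hs⟩ := Algebra.FiniteType.out (R := D) (A := D ⊗[A] S)
  choose k t m h using fun x : s ↦ TensorProduct.exists_sum_tmul_eq x.1
  refine ⟨Finset.univ.biUnion fun x : s ↦ Finset.univ.image (m x), fun T' hT' ↦ ?_⟩
  let f := Algebra.TensorProduct.map (.id D D) (Algebra.adjoin A T').val
  have hf : Function.Surjective f := by
    rw [← AlgHom.range_eq_top, _root_.eq_top_iff, ← hs, Algebra.adjoin_le_iff]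
    intro x hx
    have hm (j) : m ⟨x, hx⟩ j ∈ Algebra.adjoin A T' :=
      Algebra.subset_adjoin (hT' (by
        simp only [Finset.coe_biUnion, Set.mem_iUnion]
        exact ⟨⟨x, hx⟩, by simp, by simp⟩))
    refine ⟨∑ j, t ⟨x, hx⟩ j ⊗ₜ ⟨m ⟨x, hx⟩ j, hm j⟩, ?_⟩
    simp [f, ← h ⟨x, hx⟩]
  exact hf

lemma Ideal.lTensor_inclusion_surjective {A D P : Type*} [CommRing A] [CommRing D]
    [CommRing P] [Algebra A D] [Algebra A P] {N Q : Ideal P} [Module.Flat A (P ⧸ Q)] (hN : N ≤ Q)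
    (hD : Q.map (Algebra.TensorProduct.includeRight : P →ₐ[A] D ⊗[A] P) ≤
      N.map (Algebra.TensorProduct.includeRight : P →ₐ[A] D ⊗[A] P)) :
    Function.Surjective ((Submodule.inclusion hN :
      N.restrictScalars A →ₗ[A] Q.restrictScalars A).lTensor D) := by
  intro z
  have hz : (Q.restrictScalars A).subtype.lTensor D z ∈
      (Q.map (Algebra.TensorProduct.includeRight : P →ₐ[A] D ⊗[A] P)).restrictScalars A := by
    rw [Ideal.map_includeRight_eq]
    exact ⟨z, rfl⟩
  have hz' : (Q.restrictScalars A).subtype.lTensor D z ∈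
      (N.map (Algebra.TensorProduct.includeRight : P →ₐ[A] D ⊗[A] P)).restrictScalars A := hD hz
  rw [Ideal.map_includeRight_eq] at hz'
  obtain ⟨w, hw⟩ := hz'
  have hQ : Function.Injective ((Q.restrictScalars A).subtype.lTensor D) :=
    LinearMap.lTensor_injective_of_exact_of_flat (Ideal.Quotient.mkₐ A Q).toLinearMap
      (Ideal.Quotient.mkₐ_surjective A Q) (Q.restrictScalars A).subtype Subtype.val_injective
      (fun x ↦ by simp [Ideal.Quotient.eq_zero_iff_mem]) D
  refine ⟨w, hQ ?_⟩
  rw [← LinearMap.lTensor_comp_apply]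
  exact hw

lemma Algebra.FinitePresentation.map_includeRight_ker_fg {A D P S : Type*} [CommRing A]
    [CommRing D] [CommRing P] [CommRing S] [Algebra A D] [Algebra A P] [Algebra A S]
    [Algebra.FinitePresentation A P] [Algebra.FinitePresentation D (D ⊗[A] S)]
    (f : P →ₐ[A] S) (hf : Function.Surjective f) :
    ((RingHom.ker f).map (Algebra.TensorProduct.includeRight : P →ₐ[A] D ⊗[A] P)).FG := by
  let fD := Algebra.TensorProduct.map (.id D D) f
  have : (RingHom.ker f).map (Algebra.TensorProduct.includeRight : P →ₐ[A] D ⊗[A] P) =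
      RingHom.ker fD :=
    (Algebra.TensorProduct.lTensor_ker f hf).symm
  have hP : Algebra.FinitePresentation D (D ⊗[A] P) := .baseChange D
  have hfD : Function.Surjective fD := LinearMap.lTensor_surjective D (g := f.toLinearMap) hf
  have hfg := Algebra.FinitePresentation.ker_fG_of_surjective fD hfD
  have e : RingHom.ker fD = RingHom.ker fD.toRingHom := rfl
  rw [this, e]
  exact hfg

namespace IsMilnorPair

variable {A B C : Type*} [CommRing A] [CommRing B] [CommRing C] [Algebra A B] [Algebra A C]

theorem finiteType (h : IsMilnorPair A B C) {S : Type*} [CommRing S] [Algebra A S]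
    [Algebra.FiniteType B (B ⊗[A] S)] [Algebra.FiniteType C (C ⊗[A] S)] :
    Algebra.FiniteType A S := by
  classical
  obtain ⟨T, hT⟩ := Algebra.FiniteType.exists_finset_adjoin (A := A) (D := B) (S := S)
  obtain ⟨T', hT'⟩ := Algebra.FiniteType.exists_finset_adjoin (A := A) (D := C) (S := S)
  have := h.surjective_of_lTensor (Algebra.adjoin A ((T ∪ T' : Finset S) : Set S)).val.toLinearMap
    (hT _ (by simp)) (hT' _ (by simp))
  refine ⟨T ∪ T', ?_⟩
  rw [_root_.eq_top_iff]
  intro x _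
  obtain ⟨y, rfl⟩ := this x
  exact y.2

lemma ideal_fg (h : IsMilnorPair A B C) {P : Type*} [CommRing P] [Algebra A P] (Q : Ideal P)
    [Module.Flat A (P ⧸ Q)]
    (hB : (Q.map (Algebra.TensorProduct.includeRight : P →ₐ[A] B ⊗[A] P)).FG)
    (hC : (Q.map (Algebra.TensorProduct.includeRight : P →ₐ[A] C ⊗[A] P)).FG) : Q.FG := by
  classical
  obtain ⟨T, hTQ, hT⟩ := Q.exists_finset_map_includeRight_le hB
  obtain ⟨T', hTQ', hT'⟩ := Q.exists_finset_map_includeRight_le hC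
  refine ⟨T ∪ T', ?_⟩
  let N : Ideal P := Ideal.span ((T ∪ T' : Finset P) : Set P)
  have hN : N ≤ Q := Ideal.span_le.mpr (by simpa using ⟨hTQ, hTQ'⟩)
  have hg := h.surjective_of_lTensor
    (Submodule.inclusion hN : N.restrictScalars A →ₗ[A] Q.restrictScalars A)
    (Ideal.lTensor_inclusion_surjective hN (hT.trans (Ideal.map_mono (Ideal.span_mono (by simp)))))
    (Ideal.lTensor_inclusion_surjective hN (hT'.trans (Ideal.map_mono (Ideal.span_mono (by simp)))))
  refine le_antisymm hN fun x hx ↦ ?_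
  obtain ⟨y, hy⟩ := hg ⟨x, hx⟩
  obtain rfl : (y : P) = x := congrArg Subtype.val hy
  exact y.2

theorem finitePresentation (h : IsMilnorPair A B C) {S : Type*} [CommRing S] [Algebra A S]
    [Module.Flat A S]
    [Algebra.FinitePresentation B (B ⊗[A] S)] [Algebra.FinitePresentation C (C ⊗[A] S)] :
    Algebra.FinitePresentation A S := by
  have : Algebra.FiniteType A S := h.finiteType
  obtain ⟨n, f, hf⟩ := Algebra.FiniteType.iff_quotient_mvPolynomial''.mp this
  refine .of_surjective hf ?_
  have : Module.Flat A (MvPolynomial (Fin n) A ⧸ RingHom.ker f.toRingHom) :=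
    .of_linearEquiv (Ideal.quotientKerAlgEquivOfSurjective hf).toLinearEquiv
  exact h.ideal_fg _ (Algebra.FinitePresentation.map_includeRight_ker_fg f hf)
    (Algebra.FinitePresentation.map_includeRight_ker_fg f hf)

end IsMilnorPair

end MilnorPair

section PullbackSquare

open TensorProduct

/-- `A` is the fiber product of `A₁` and `A₂` over `A₃`. -/
structure IsPullbackSquare (A A₁ A₂ A₃ : Type*) [CommRing A] [CommRing A₁] [CommRing A₂]
    [CommRing A₃] [Algebra A A₁] [Algebra A A₂] [Algebra A₁ A₃] [Algebra A₂ A₃] : Prop where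
  eq_zero : ∀ a : A, algebraMap A A₁ a = 0 → algebraMap A A₂ a = 0 → a = 0
  exists_lift : ∀ (a₁ : A₁) (a₂ : A₂), algebraMap A₁ A₃ a₁ = algebraMap A₂ A₃ a₂ →
    ∃ a : A, algebraMap A A₁ a = a₁ ∧ algebraMap A A₂ a = a₂

namespace Algebra.IsPushout

variable {R S R' S' : Type*} [CommRing R] [CommRing S] [CommRing R'] [CommRing S']
  [Algebra R S] [Algebra R R'] [Algebra S S'] [Algebra R' S'] [Algebra R S']
  [IsScalarTower R R' S'] [IsScalarTower R S S']

variable (R S) in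
lemma surjective_of_surjective [Algebra.IsPushout R S R' S']
    (h : Function.Surjective (algebraMap R S)) : Function.Surjective (algebraMap R' S') := by
  intro x
  obtain ⟨t, rfl⟩ := (Algebra.IsPushout.equiv R S R' S').surjective x
  induction t with
  | zero => exact ⟨0, by simp⟩
  | add x y hx hy =>
    obtain ⟨a, ha⟩ := hx
    obtain ⟨b, hb⟩ := hy
    exact ⟨a + b, by rw [map_add, map_add, ha, hb]⟩
  | tmul s r =>
    obtain ⟨s, rfl⟩ := h s
    refine ⟨algebraMap R R' s * r, ?_⟩
    rw [Algebra.IsPushout.equiv_tmul, map_mul, ← IsScalarTower.algebraMap_apply,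
      ← IsScalarTower.algebraMap_apply]

variable (S) in
lemma mem_map_ker_of_surjective [Algebra.IsPushout R S R' S']
    (h : Function.Surjective (algebraMap R S)) {x : R'} (hx : algebraMap R' S' x = 0) :
    x ∈ (RingHom.ker (algebraMap R S)).map (algebraMap R R') := by
  let K := RingHom.ker (algebraMap R S)
  have hex : Function.Exact (K.subtype.rTensor R') ((Algebra.linearMap R S).rTensor R') :=
    rTensor_exact R' (fun x ↦ ⟨fun hx ↦ ⟨⟨x, hx⟩, rfl⟩, fun ⟨w, hw⟩ ↦ hw ▸ w.2⟩) h
  obtain ⟨w, hw⟩ := (hex ((1 : R) ⊗ₜ x)).mp (by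
    apply (Algebra.IsPushout.equiv R S R' S').injective
    simp [Algebra.IsPushout.equiv_tmul, hx])
  have key : ∀ w, TensorProduct.lid R R' (K.subtype.rTensor R' w) ∈
      K.map (algebraMap R R') := by
    intro w
    induction w with
    | zero => simp
    | add x y hx hy => rw [map_add, map_add]; exact add_mem hx hy
    | tmul i r =>
      simpa [Algebra.smul_def] using Ideal.mul_mem_right r _ (Ideal.mem_map_of_mem _ i.2)
  simpa [hw] using key w

/-- The canonical map from `S ⊗[R] R'` to an algebra `S'` over both `S` and `R'`. -/
noncomputable def _root_.Algebra.TensorProduct.liftAlgebraMap (R S R' S' : Type*) [CommRing R]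
    [CommRing S] [CommRing R'] [CommRing S'] [Algebra R S] [Algebra R R'] [Algebra S S']
    [Algebra R' S'] [Algebra R S'] [IsScalarTower R R' S'] [IsScalarTower R S S'] :
    S ⊗[R] R' →ₐ[S] S' :=
  Algebra.TensorProduct.lift (Algebra.ofId S S') (IsScalarTower.toAlgHom R R' S')
    fun _ _ ↦ Commute.all _ _

@[simp]
lemma _root_.Algebra.TensorProduct.liftAlgebraMap_tmul (s : S) (r : R') :
    Algebra.TensorProduct.liftAlgebraMap R S R' S' (s ⊗ₜ r) =
      algebraMap S S' s * algebraMap R' S' r := by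
  simp [Algebra.TensorProduct.liftAlgebraMap, Algebra.ofId_apply]

lemma of_bijective_liftAlgebraMap
    (h : Function.Bijective (Algebra.TensorProduct.liftAlgebraMap R S R' S')) :
    Algebra.IsPushout R S R' S' :=
  ⟨.of_equiv (LinearEquiv.ofBijective
    (Algebra.TensorProduct.liftAlgebraMap R S R' S').toLinearMap h) fun r ↦
      (Algebra.TensorProduct.liftAlgebraMap_tmul 1 r).trans (by rw [map_one, one_mul]; rfl)⟩

end Algebra.IsPushout

namespace IsPullbackSquare

variable {A A₁ A₂ A₃ : Type*} [CommRing A] [CommRing A₁] [CommRing A₂] [CommRing A₃]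
  [Algebra A A₁] [Algebra A₁ A₃] [Algebra A₂ A₃]

lemma surjective [Algebra A A₂] (hA : IsPullbackSquare A A₁ A₂ A₃)
    (h₁ : Function.Surjective (algebraMap A₁ A₃)) : Function.Surjective (algebraMap A A₂) := by
  intro a₂
  obtain ⟨a₁, ha₁⟩ := h₁ (algebraMap A₂ A₃ a₂)
  obtain ⟨a, -, ha⟩ := hA.exists_lift a₁ a₂ ha₁
  exact ⟨a, ha⟩

variable {B B₁ B₂ B₃ : Type*} [CommRing B] [CommRing B₁] [CommRing B₂] [CommRing B₃]
  [Algebra B B₁] [Algebra B B₂] [Algebra B B₃] [Algebra B₁ B₃] [Algebra B₂ B₃]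
  [IsScalarTower B B₁ B₃] [IsScalarTower B B₂ B₃]
  [Algebra A B] [Algebra A B₁] [Algebra A₁ B₁] [IsScalarTower A B B₁] [IsScalarTower A A₁ B₁]
  [Algebra A₂ B₂] [Algebra A₃ B₃] [Algebra A₁ B₃] [Algebra A₂ B₃]
  [IsScalarTower A₁ A₃ B₃] [IsScalarTower A₁ B₁ B₃]
  [IsScalarTower A₂ A₃ B₃] [IsScalarTower A₂ B₂ B₃]

lemma liftAlgebraMap_surjective (hB : IsPullbackSquare B B₁ B₂ B₃)
    (hP₁ : Algebra.IsPushout A₁ A₃ B₁ B₃) (hP₂ : Algebra.IsPushout A₂ A₃ B₂ B₃)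
    (h₁ : Function.Surjective (algebraMap A₁ A₃)) :
    Function.Surjective (Algebra.TensorProduct.liftAlgebraMap A A₁ B B₁) := by
  have hB₂ := hB.surjective (Algebra.IsPushout.surjective_of_surjective A₁ A₃ h₁)
  have key (x : B₃) : ∃ z,
      algebraMap B₁ B₃ (Algebra.TensorProduct.liftAlgebraMap A A₁ B B₁ z) = x := by
    obtain ⟨t, rfl⟩ := (Algebra.IsPushout.equiv A₂ A₃ B₂ B₃).surjective x
    induction t with
    | zero => exact ⟨0, by simp⟩
    | add x y hx hy =>
      obtain ⟨a, ha⟩ := hx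
      obtain ⟨b, hb⟩ := hy
      exact ⟨a + b, by rw [map_add, map_add, map_add, ha, hb]⟩
    | tmul a b =>
      obtain ⟨a, rfl⟩ := h₁ a
      obtain ⟨b, rfl⟩ := hB₂ b
      refine ⟨a ⊗ₜ b, ?_⟩
      rw [Algebra.TensorProduct.liftAlgebraMap_tmul, Algebra.IsPushout.equiv_tmul, map_mul,
        ← IsScalarTower.algebraMap_apply A₁ B₁ B₃, ← IsScalarTower.algebraMap_apply A₁ A₃ B₃,
        ← IsScalarTower.algebraMap_apply B B₁ B₃, ← IsScalarTower.algebraMap_apply B B₂ B₃]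
  intro b
  obtain ⟨z, hz⟩ := key (algebraMap B₁ B₃ b)
  obtain ⟨c, hc, -⟩ := hB.exists_lift
    (b - Algebra.TensorProduct.liftAlgebraMap A A₁ B B₁ z) 0 (by simp [hz])
  exact ⟨z + 1 ⊗ₜ c, by simp [hc]⟩

variable [Algebra A A₂] [Algebra A A₃] [IsScalarTower A A₁ A₃] [IsScalarTower A A₂ A₃]

lemma isMilnorPair (hA : IsPullbackSquare A A₁ A₂ A₃)
    (h₁ : Function.Surjective (algebraMap A₁ A₃)) : IsMilnorPair A A₁ A₂ where
  surjective := hA.surjective h₁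
  eq_zero a h₂ h₁ := hA.eq_zero a h₁ h₂
  exists_mul i hi b := by
    obtain ⟨j, hj₁, hj₂⟩ := hA.exists_lift (b * algebraMap A A₁ i) 0 (by
      rw [map_mul, ← IsScalarTower.algebraMap_apply A A₁ A₃,
        IsScalarTower.algebraMap_apply A A₂ A₃, hi, map_zero, mul_zero])
    exact ⟨j, hj₂, hj₁⟩

variable [Algebra A B₂] [Algebra A B₃] [IsScalarTower A B B₂] [IsScalarTower A A₂ B₂]
  [IsScalarTower A B B₃] [IsScalarTower A A₃ B₃] [IsScalarTower A B₂ B₃]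

lemma isPushout_right (hA : IsPullbackSquare A A₁ A₂ A₃) (hB : IsPullbackSquare B B₁ B₂ B₃)
    (hP₁ : Algebra.IsPushout A₁ A₃ B₁ B₃) (hP₂ : Algebra.IsPushout A₂ A₃ B₂ B₃)
    (h₁ : Function.Surjective (algebraMap A₁ A₃)) : Algebra.IsPushout A A₂ B B₂ := by
  have hA₂ := hA.surjective h₁
  have hB₂ := hB.surjective (Algebra.IsPushout.surjective_of_surjective A₁ A₃ h₁)
  have key (x : B₁) (hx : x ∈ (RingHom.ker (algebraMap A₁ A₃)).map (algebraMap A₁ B₁)) :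
      ∃ c : B, algebraMap B B₁ c = x ∧ algebraMap B B₂ c = 0 ∧ (1 : A₂) ⊗ₜ[A] c = 0 := by
    induction hx using Submodule.closure_induction with
    | zero => exact ⟨0, by simp⟩
    | add x y _ _ hx hy =>
      obtain ⟨c, hc₁, hc₂, hc⟩ := hx
      obtain ⟨d, hd₁, hd₂, hd⟩ := hy
      exact ⟨c + d, by simp [hc₁, hd₁], by simp [hc₂, hd₂], by rw [tmul_add, hc, hd, add_zero]⟩
    | smul_mem y x hx =>
      obtain ⟨i, hi, rfl⟩ := hx
      obtain ⟨z, rfl⟩ := hB.liftAlgebraMap_surjective (A := A) hP₁ hP₂ h₁ y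
      induction z with
      | zero => exact ⟨0, by simp⟩
      | add x y hx hy =>
        obtain ⟨c, hc₁, hc₂, hc⟩ := hx
        obtain ⟨d, hd₁, hd₂, hd⟩ := hy
        exact ⟨c + d, by rw [map_add, map_add, add_smul, hc₁, hd₁], by simp [hc₂, hd₂],
          by rw [tmul_add, hc, hd, add_zero]⟩
      | tmul a b =>
        obtain ⟨j, hj₁, hj₂⟩ := hA.exists_lift (a * i) 0 (by
          rw [map_mul, show algebraMap A₁ A₃ i = 0 from hi, mul_zero, map_zero])
        refine ⟨j • b, ?_, ?_, ?_⟩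
        · rw [Algebra.smul_def, map_mul, ← IsScalarTower.algebraMap_apply A B B₁,
            IsScalarTower.algebraMap_apply A A₁ B₁, hj₁,
            Algebra.TensorProduct.liftAlgebraMap_tmul, map_mul, smul_eq_mul]
          ring
        · rw [Algebra.smul_def, map_mul, ← IsScalarTower.algebraMap_apply A B B₂,
            IsScalarTower.algebraMap_apply A A₂ B₂, hj₂, map_zero, zero_mul]
        · rw [← smul_tmul, Algebra.smul_def, hj₂, zero_mul, zero_tmul]
  refine .of_bijective_liftAlgebraMap ⟨(injective_iff_map_eq_zero _).mpr fun z hz ↦ ?_, fun b ↦ ?_⟩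
  · obtain ⟨b, rfl⟩ : ∃ b : B, (1 : A₂) ⊗ₜ[A] b = z := TensorProduct.mk_surjective A B A₂ hA₂ z
    simp only [Algebra.TensorProduct.liftAlgebraMap_tmul, map_one, one_mul] at hz
    obtain ⟨c, hc₁, hc₂, hc⟩ := key (algebraMap B B₁ b)
      (Algebra.IsPushout.mem_map_ker_of_surjective A₃ (S' := B₃) h₁ (by
        rw [← IsScalarTower.algebraMap_apply, IsScalarTower.algebraMap_apply B B₂ B₃, hz, map_zero]))
    obtain rfl : c = b := by
      rw [← sub_eq_zero]
      exact hB.eq_zero _ (by simp [hc₁]) (by simp [hc₂, hz])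
    exact hc
  · obtain ⟨b, rfl⟩ := hB₂ b
    exact ⟨1 ⊗ₜ b, by simp⟩

lemma isPushout_left (hA : IsPullbackSquare A A₁ A₂ A₃) (hB : IsPullbackSquare B B₁ B₂ B₃)
    (hP₁ : Algebra.IsPushout A₁ A₃ B₁ B₃) (hP₂ : Algebra.IsPushout A₂ A₃ B₂ B₃)
    (h₁ : Function.Surjective (algebraMap A₁ A₃)) : Algebra.IsPushout A A₁ B B₁ := by
  have : Algebra.IsPushout A A₂ B B₂ := hA.isPushout_right hB hP₁ hP₂ h₁
  have : Algebra.IsPushout A A₃ B B₃ := (Algebra.IsPushout.comp_iff A A₂ B B₂).mpr hP₂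
  let p : A₁ →ₗ[A] A₃ := (IsScalarTower.toAlgHom A A₁ A₃).toLinearMap
  refine .of_bijective_liftAlgebraMap ⟨(injective_iff_map_eq_zero _).mpr fun z hz ↦ ?_,
    hB.liftAlgebraMap_surjective hP₁ hP₂ h₁⟩
  have hp : ∀ z, Algebra.IsPushout.equiv A A₃ B B₃ (p.rTensor B z) =
      algebraMap B₁ B₃ (Algebra.TensorProduct.liftAlgebraMap A A₁ B B₁ z) := by
    intro z
    induction z with
    | zero => simp
    | add x y hx hy => rw [map_add, map_add, map_add, map_add, hx, hy]
    | tmul a b =>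
      simp [p, Algebra.IsPushout.equiv_tmul, ← IsScalarTower.algebraMap_apply]
  have hex : Function.Exact ((LinearMap.ker p).subtype.rTensor B) (p.rTensor B) :=
    rTensor_exact B (LinearMap.exact_subtype_ker_map p) h₁
  obtain ⟨w, rfl⟩ := (hex z).mp (by
    apply (Algebra.IsPushout.equiv A A₃ B B₃).injective
    rw [hp, hz, map_zero, map_zero])
  have key (w) : ∃ c : B, algebraMap B B₂ c = 0 ∧
      (LinearMap.ker p).subtype.rTensor B w = (1 : A₁) ⊗ₜ[A] c := by
    induction w with
    | zero => exact ⟨0, by simp⟩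
    | add x y hx hy =>
      obtain ⟨c, hc₂, hc⟩ := hx
      obtain ⟨d, hd₂, hd⟩ := hy
      exact ⟨c + d, by simp [hc₂, hd₂], by rw [tmul_add, map_add, hc, hd]⟩
    | tmul i b =>
      obtain ⟨j, hj₁, hj₂⟩ := hA.exists_lift i 0 (by
        rw [map_zero]
        exact i.2)
      refine ⟨j • b, ?_, ?_⟩
      · rw [Algebra.smul_def, map_mul, ← IsScalarTower.algebraMap_apply A B B₂,
          IsScalarTower.algebraMap_apply A A₂ B₂, hj₂, map_zero, zero_mul]
      · rw [← smul_tmul, Algebra.smul_def, hj₁, mul_one]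
        rfl
  obtain ⟨c, hc₂, hc⟩ := key w
  rw [hc] at hz ⊢
  simp only [Algebra.TensorProduct.liftAlgebraMap_tmul, map_one, one_mul] at hz
  rw [hB.eq_zero c hz hc₂, tmul_zero]

theorem flat_and_finitePresentation (hA : IsPullbackSquare A A₁ A₂ A₃)
    (hB : IsPullbackSquare B B₁ B₂ B₃)
    (hP₁ : Algebra.IsPushout A₁ A₃ B₁ B₃) (hP₂ : Algebra.IsPushout A₂ A₃ B₂ B₃)
    (h₁ : Function.Surjective (algebraMap A₁ A₃))
    [Module.Flat A₁ B₁] [Module.Flat A₂ B₂]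
    [Algebra.FinitePresentation A₁ B₁] [Algebra.FinitePresentation A₂ B₂] :
    Module.Flat A B ∧ Algebra.FinitePresentation A B := by
  have h := hA.isMilnorPair h₁
  have : Algebra.IsPushout A A₁ B B₁ := hA.isPushout_left hB hP₁ hP₂ h₁
  have : Algebra.IsPushout A A₂ B B₂ := hA.isPushout_right hB hP₁ hP₂ h₁
  let e₁ := Algebra.IsPushout.equiv A A₁ B B₁
  let e₂ := Algebra.IsPushout.equiv A A₂ B B₂
  have : Module.Flat A₁ (A₁ ⊗[A] B) := .of_linearEquiv e₁.toLinearEquiv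
  have : Module.Flat A₂ (A₂ ⊗[A] B) := .of_linearEquiv e₂.toLinearEquiv
  have : Algebra.FinitePresentation A₁ (A₁ ⊗[A] B) := .equiv e₁.symm
  have : Algebra.FinitePresentation A₂ (A₂ ⊗[A] B) := .equiv e₂.symm
  have : Module.Flat A B := h.flat
  exact ⟨this, h.finitePresentation⟩

end IsPullbackSquare

end PullbackSquare

/-- The fiber product ring, with its two projections, is a fiber product. -/
lemma isPullbackSquare_ringFiberProd (A₁ A₂ A₃ : Type*) [CommRing A₁] [CommRing A₂] [CommRing A₃]
    [Algebra A₁ A₃] [Algebra A₂ A₃] :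
    letI : Algebra (ringFiberProd A₁ A₂ A₃) A₁ :=
      ((RingHom.fst A₁ A₂).comp (ringFiberProd A₁ A₂ A₃).subtype).toAlgebra
    letI : Algebra (ringFiberProd A₁ A₂ A₃) A₂ :=
      ((RingHom.snd A₁ A₂).comp (ringFiberProd A₁ A₂ A₃).subtype).toAlgebra
    IsPullbackSquare (ringFiberProd A₁ A₂ A₃) A₁ A₂ A₃ :=
  letI : Algebra (ringFiberProd A₁ A₂ A₃) A₁ :=
    ((RingHom.fst A₁ A₂).comp (ringFiberProd A₁ A₂ A₃).subtype).toAlgebra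
  letI : Algebra (ringFiberProd A₁ A₂ A₃) A₂ :=
    ((RingHom.snd A₁ A₂).comp (ringFiberProd A₁ A₂ A₃).subtype).toAlgebra
  { eq_zero := fun _ h₁ h₂ ↦ Subtype.ext (Prod.ext h₁ h₂)
    exists_lift := fun a₁ a₂ h ↦ ⟨⟨(a₁, a₂), h⟩, rfl, rfl⟩ }

section

variable (A1 A2 A3 A1' A2' A3' : Type*)
  [CommRing A1] [CommRing A2] [CommRing A3]
  [CommRing A1'] [CommRing A2'] [CommRing A3']
  [Algebra A1 A3] [Algebra A2 A3]
  [Algebra A1 A1'] [Algebra A2 A2'] [Algebra A3 A3']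
  [Algebra A1' A3'] [Algebra A2' A3']
  [Algebra A1 A3'] [Algebra A2 A3']
  [IsScalarTower A1 A3 A3'] [IsScalarTower A1 A1' A3']
  [IsScalarTower A2 A3 A3'] [IsScalarTower A2 A2' A3']

/-- Let `[A₁ ← A₃ → A₂]` be a diagram of commutative rings with
`A₁ → A₃` surjective. Given flat, finitely presented ring maps `gᵢ : Aᵢ → Aᵢ'`
compatible with base-change isomorphisms `A₃' ≅ A₃ ⊗_{A₁} A₁' ≅ A₃ ⊗_{A₂} A₂'`
(expressed as pushout squares), the induced map
`A₁ ×_{A₃} A₂ → A₁' ×_{A₃'} A₂'` is flat and finitely presented. -/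
theorem ringFiberProdMap_flat_finitePresentation
    (ht₁ : Function.Surjective (algebraMap A1 A3))
    [Module.Flat A1 A1'] [Module.Flat A2 A2'] [Module.Flat A3 A3']
    (hfp1 : Algebra.FinitePresentation A1 A1')
    (hfp2 : Algebra.FinitePresentation A2 A2')
    (hfp3 : Algebra.FinitePresentation A3 A3')
    [Algebra.IsPushout A1 A3 A1' A3'] [Algebra.IsPushout A2 A3 A2' A3'] :
    letI : Algebra (ringFiberProd A1 A2 A3) (ringFiberProd A1' A2' A3') :=
      (ringFiberProdMap A1 A2 A3 A1' A2' A3').toAlgebra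
    Module.Flat (ringFiberProd A1 A2 A3) (ringFiberProd A1' A2' A3') ∧
      Algebra.FinitePresentation (ringFiberProd A1 A2 A3) (ringFiberProd A1' A2' A3') := by
  let : Algebra (ringFiberProd A1 A2 A3) (ringFiberProd A1' A2' A3') :=
    (ringFiberProdMap A1 A2 A3 A1' A2' A3').toAlgebra
  let : Algebra (ringFiberProd A1 A2 A3) A1 :=
    ((RingHom.fst A1 A2).comp (ringFiberProd A1 A2 A3).subtype).toAlgebra
  let : Algebra (ringFiberProd A1 A2 A3) A2 :=
    ((RingHom.snd A1 A2).comp (ringFiberProd A1 A2 A3).subtype).toAlgebra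
  let : Algebra (ringFiberProd A1 A2 A3) A3 :=
    ((algebraMap A1 A3).comp (algebraMap (ringFiberProd A1 A2 A3) A1)).toAlgebra
  let : Algebra (ringFiberProd A1' A2' A3') A1' :=
    ((RingHom.fst A1' A2').comp (ringFiberProd A1' A2' A3').subtype).toAlgebra
  let : Algebra (ringFiberProd A1' A2' A3') A2' :=
    ((RingHom.snd A1' A2').comp (ringFiberProd A1' A2' A3').subtype).toAlgebra
  let : Algebra (ringFiberProd A1' A2' A3') A3' :=
    ((algebraMap A1' A3').comp (algebraMap (ringFiberProd A1' A2' A3') A1')).toAlgebra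
  let : Algebra (ringFiberProd A1 A2 A3) A1' :=
    ((algebraMap A1 A1').comp (algebraMap (ringFiberProd A1 A2 A3) A1)).toAlgebra
  let : Algebra (ringFiberProd A1 A2 A3) A2' :=
    ((algebraMap A2 A2').comp (algebraMap (ringFiberProd A1 A2 A3) A2)).toAlgebra
  let : Algebra (ringFiberProd A1 A2 A3) A3' :=
    ((algebraMap A3 A3').comp (algebraMap (ringFiberProd A1 A2 A3) A3)).toAlgebra
  have h : ∀ x : ringFiberProd A1 A2 A3,
      algebraMap A1 A3 (x : A1 × A2).1 = algebraMap A2 A3 (x : A1 × A2).2 := fun x ↦ x.2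
  have h' : ∀ x : ringFiberProd A1' A2' A3',
      algebraMap A1' A3' (x : A1' × A2').1 = algebraMap A2' A3' (x : A1' × A2').2 := fun x ↦ x.2
  have : IsScalarTower (ringFiberProd A1 A2 A3) A1 A3 := .of_algebraMap_eq fun _ ↦ rfl
  have : IsScalarTower (ringFiberProd A1 A2 A3) A2 A3 := .of_algebraMap_eq h
  have : IsScalarTower (ringFiberProd A1' A2' A3') A1' A3' := .of_algebraMap_eq fun _ ↦ rfl
  have : IsScalarTower (ringFiberProd A1' A2' A3') A2' A3' := .of_algebraMap_eq h'
  have : IsScalarTower (ringFiberProd A1 A2 A3) A1 A1' := .of_algebraMap_eq fun _ ↦ rfl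
  have : IsScalarTower (ringFiberProd A1 A2 A3) A2 A2' := .of_algebraMap_eq fun _ ↦ rfl
  have : IsScalarTower (ringFiberProd A1 A2 A3) A3 A3' := .of_algebraMap_eq fun _ ↦ rfl
  have : IsScalarTower (ringFiberProd A1 A2 A3) (ringFiberProd A1' A2' A3') A1' :=
    .of_algebraMap_eq fun _ ↦ rfl
  have : IsScalarTower (ringFiberProd A1 A2 A3) (ringFiberProd A1' A2' A3') A2' :=
    .of_algebraMap_eq fun _ ↦ rfl
  have : IsScalarTower (ringFiberProd A1 A2 A3) A2' A3' := .of_algebraMap_eq fun x ↦ by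
    rw [IsScalarTower.algebraMap_apply _ A3 A3', IsScalarTower.algebraMap_apply _ A2 A3,
      IsScalarTower.algebraMap_apply _ A2 A2', ← IsScalarTower.algebraMap_apply A2 A3 A3',
      ← IsScalarTower.algebraMap_apply A2 A2' A3']
  have : IsScalarTower (ringFiberProd A1 A2 A3) (ringFiberProd A1' A2' A3') A3' :=
    .of_algebraMap_eq fun x ↦ by
      rw [IsScalarTower.algebraMap_apply _ A2' A3',
        IsScalarTower.algebraMap_apply _ (ringFiberProd A1' A2' A3') A2',
        ← IsScalarTower.algebraMap_apply _ A2' A3']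
  exact (isPullbackSquare_ringFiberProd A1 A2 A3).flat_and_finitePresentation
    (isPullbackSquare_ringFiberProd A1' A2' A3') inferInstance inferInstance ht₁

end
end

section
/- Let [A₁ ← A₃ → A₂] be a diagram of commutative rings with A₁ → A₃ surjective, let gᵢ : Aᵢ → Aᵢ' be faithfully flat ring maps compatible with the base-change isomorphisms A₃' ≅ A₃ ⊗_{A₁} A₁' ≅ A₃ ⊗_{A₂} A₂'. Then the induced map A₁ ×_{A₃} A₂ → A₁' ×_{A₃'} A₂' is faithfully flat. -/
section

open TensorProduct

theorem LinearMap.rTensor_injective_of_lTensor_injective {R : Type*} [CommRing R]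
    {X Y N K F M : Type*} [AddCommGroup X] [AddCommGroup Y] [AddCommGroup N] [AddCommGroup K]
    [AddCommGroup F] [AddCommGroup M] [Module R X] [Module R Y] [Module R N] [Module R K]
    [Module R F] [Module R M] {f : X →ₗ[R] Y} {g : Y →ₗ[R] N} {i : K →ₗ[R] F} {p : F →ₗ[R] M}
    (hfg : Function.Exact f g) (hg : Function.Surjective g)
    (hip : Function.Exact i p) (hp : Function.Surjective p)
    (hF : Function.Injective (f.rTensor F)) (hN : Function.Injective (i.lTensor N)) :
    Function.Injective (f.rTensor M) := by
  rw [injective_iff_map_eq_zero]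
  intro x hx
  obtain ⟨y, rfl⟩ := LinearMap.lTensor_surjective X hp x
  rw [← LinearMap.comp_apply, LinearMap.rTensor_comp_lTensor, ← LinearMap.lTensor_comp_rTensor,
    LinearMap.comp_apply] at hx
  obtain ⟨z, hz⟩ := (lTensor_exact Y hip hp _).mp hx
  have hz' : g.rTensor K z = 0 := by
    apply hN
    rw [← LinearMap.comp_apply, LinearMap.lTensor_comp_rTensor, ← LinearMap.rTensor_comp_lTensor,
      LinearMap.comp_apply, hz, map_zero]
    exact (rTensor_exact F hfg hg _).mpr ⟨y, rfl⟩
  obtain ⟨w, rfl⟩ := (rTensor_exact K hfg hg _).mp hz'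
  have hw : i.lTensor X w = y := by
    apply hF
    rw [← hz, ← LinearMap.comp_apply, ← LinearMap.comp_apply, LinearMap.lTensor_comp_rTensor,
      LinearMap.rTensor_comp_lTensor]
  rw [← hw]
  exact (lTensor_exact X hip hp _).mpr ⟨w, rfl⟩

theorem LinearMap.lTensor_injective_of_rTensor_injective {R : Type*} [CommRing R]
    {X Y N K F M : Type*} [AddCommGroup X] [AddCommGroup Y] [AddCommGroup N] [AddCommGroup K]
    [AddCommGroup F] [AddCommGroup M] [Module R X] [Module R Y] [Module R N] [Module R K]
    [Module R F] [Module R M] {f : X →ₗ[R] Y} {g : Y →ₗ[R] N} {i : K →ₗ[R] F} {p : F →ₗ[R] M}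
    (hfg : Function.Exact f g) (hg : Function.Surjective g)
    (hip : Function.Exact i p) (hp : Function.Surjective p)
    (hY : Function.Injective (i.lTensor Y)) (hM : Function.Injective (f.rTensor M)) :
    Function.Injective (i.lTensor N) := by
  rw [LinearMap.lTensor_inj_iff_rTensor_inj] at hY ⊢
  rw [← LinearMap.lTensor_inj_iff_rTensor_inj] at hM
  exact LinearMap.rTensor_injective_of_lTensor_injective hip hp hfg hg hY hM

/-- The tautological free module surjecting onto `M`. -/
def FreeCover (R M : Type*) [CommRing R] : Type _ := M →₀ R

noncomputable instance (R M : Type*) [CommRing R] : AddCommGroup (FreeCover R M) :=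
  inferInstanceAs (AddCommGroup (M →₀ R))

noncomputable instance (R M : Type*) [CommRing R] : Module R (FreeCover R M) :=
  inferInstanceAs (Module R (M →₀ R))

instance (R M : Type*) [CommRing R] : Module.Free R (FreeCover R M) :=
  inferInstanceAs (Module.Free R (M →₀ R))

/-- The canonical surjection from the tautological free module. -/
noncomputable def FreeCover.proj (R M : Type*) [CommRing R] [AddCommGroup M] [Module R M] :
    FreeCover R M →ₗ[R] M :=
  Finsupp.linearCombination R (id : M → M)

theorem FreeCover.proj_surjective (R M : Type*) [CommRing R] [AddCommGroup M] [Module R M] :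
    Function.Surjective (FreeCover.proj R M) :=
  Finsupp.linearCombination_id_surjective R M

/-- The kernel of the tautological free presentation of `M`. -/
noncomputable abbrev relationModule (R M : Type*) [CommRing R] [AddCommGroup M] [Module R M] :
    Submodule R (FreeCover R M) :=
  LinearMap.ker (FreeCover.proj R M)

theorem relationModule_exact (R M : Type*) [CommRing R] [AddCommGroup M] [Module R M] :
    Function.Exact (relationModule R M).subtype (FreeCover.proj R M) :=
  LinearMap.exact_subtype_ker_map _

/-- `Tor₁(N, M) = 0`, expressed through the tautological free presentation of `M`. -/
def TorOneVanishes (R N M : Type*) [CommRing R] [AddCommGroup N] [Module R N]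
    [AddCommGroup M] [Module R M] : Prop :=
  Function.Injective ((relationModule R M).subtype.lTensor N)

/-- A pure submodule criterion: an injection with flat cokernel stays injective after tensoring. -/
theorem LinearMap.lTensor_injective_of_flat_cokernel {R K F M : Type*} [CommRing R]
    [AddCommGroup K] [AddCommGroup F] [AddCommGroup M] [Module R K] [Module R F] [Module R M]
    [Module.Flat R M] {i : K →ₗ[R] F} {p : F →ₗ[R] M} (hi : Function.Injective i)
    (hip : Function.Exact i p) (hp : Function.Surjective p)
    (N : Type*) [AddCommGroup N] [Module R N] :
    Function.Injective (i.lTensor N) :=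
  LinearMap.lTensor_injective_of_rTensor_injective (relationModule_exact R N)
    (FreeCover.proj_surjective R N) hip hp
    (Module.Flat.lTensor_preserves_injective_linearMap i hi)
    (Module.Flat.rTensor_preserves_injective_linearMap _ (Submodule.subtype_injective _))

theorem Module.Flat.of_exact {R K F M : Type*} [CommRing R]
    [AddCommGroup K] [AddCommGroup F] [AddCommGroup M] [Module R K] [Module R F] [Module R M]
    [Module.Flat R M] [Module.Flat R F] {i : K →ₗ[R] F} {p : F →ₗ[R] M}
    (hi : Function.Injective i) (hip : Function.Exact i p) (hp : Function.Surjective p) :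
    Module.Flat R K := by
  refine Module.Flat.iff_rTensor_injectiveₛ.mpr fun P _ _ N ↦ ?_
  let : AddCommGroup P := Module.addCommMonoidToAddCommGroup R
  have h : Function.Injective (i.lTensor P ∘ₗ N.subtype.rTensor K) := by
    rw [LinearMap.lTensor_comp_rTensor, ← LinearMap.rTensor_comp_lTensor]
    exact (Module.Flat.rTensor_preserves_injective_linearMap (M := F) N.subtype
      N.subtype_injective).comp (LinearMap.lTensor_injective_of_flat_cokernel hi hip hp N)
  exact Function.Injective.of_comp h

namespace TorOneVanishes

section

variable {R : Type*} [CommRing R] {X Y N M : Type*} [AddCommGroup X] [AddCommGroup Y]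
  [AddCommGroup N] [AddCommGroup M] [Module R X] [Module R Y] [Module R N] [Module R M]
  {f : X →ₗ[R] Y} {g : Y →ₗ[R] N}

theorem rTensor_injective (h : TorOneVanishes R N M) (hf : Function.Injective f)
    (hfg : Function.Exact f g) (hg : Function.Surjective g) : Function.Injective (f.rTensor M) :=
  LinearMap.rTensor_injective_of_lTensor_injective hfg hg (relationModule_exact R M)
    (FreeCover.proj_surjective R M)
    (Module.Flat.rTensor_preserves_injective_linearMap f hf) h

theorem of_rTensor_injective [Module.Flat R Y] (hfg : Function.Exact f g)
    (hg : Function.Surjective g) (h : Function.Injective (f.rTensor M)) : TorOneVanishes R N M :=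
  LinearMap.lTensor_injective_of_rTensor_injective hfg hg (relationModule_exact R M)
    (FreeCover.proj_surjective R M)
    (Module.Flat.lTensor_preserves_injective_linearMap _ (Submodule.subtype_injective _)) h

theorem congr (e : X ≃ₗ[R] Y) (h : TorOneVanishes R X M) : TorOneVanishes R Y M := by
  have h' : Function.Injective ((relationModule R M).subtype.lTensor Y ∘ₗ
      (e.rTensor (relationModule R M)).toLinearMap) := by
    have : (relationModule R M).subtype.lTensor Y ∘ₗ (e.rTensor (relationModule R M)).toLinearMap =
        (e.rTensor (FreeCover R M)).toLinearMap ∘ₗ (relationModule R M).subtype.lTensor X :=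
      TensorProduct.ext' fun _ _ ↦ rfl
    rw [this]
    exact (e.rTensor (FreeCover R M)).injective.comp h
  exact (Function.Injective.of_comp_iff' _ (e.rTensor (relationModule R M)).bijective).mp h'

theorem of_extension (hf : Function.Injective f) (hfg : Function.Exact f g)
    (hg : Function.Surjective g) (hX : TorOneVanishes R X M) (hN : TorOneVanishes R N M) :
    TorOneVanishes R Y M := by
  rw [TorOneVanishes, injective_iff_map_eq_zero]
  intro y hy
  have hy' : g.rTensor _ y = 0 := by
    apply hN
    rw [← LinearMap.comp_apply, LinearMap.lTensor_comp_rTensor, ← LinearMap.rTensor_comp_lTensor,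
      LinearMap.comp_apply, hy, map_zero, map_zero]
  obtain ⟨x, rfl⟩ := (rTensor_exact _ hfg hg _).mp hy'
  rw [← LinearMap.comp_apply, LinearMap.lTensor_comp_rTensor, ← LinearMap.rTensor_comp_lTensor,
      LinearMap.comp_apply] at hy
  have := (injective_iff_map_eq_zero _).mp hX x ((injective_iff_map_eq_zero _).mp
    (Module.Flat.rTensor_preserves_injective_linearMap (M := FreeCover R M) f hf) _ hy)
  rw [this, map_zero]

/-- If `Tor₁(Y, M) = 0` and `Tor₂(Y / X, M) = 0`, then `Tor₁(X, M) = 0`. -/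
theorem of_cokernel (hf : Function.Injective f) (hfg : Function.Exact f g)
    (hg : Function.Surjective g) (hY : TorOneVanishes R Y M)
    (hN : TorOneVanishes R N (relationModule R M)) : TorOneVanishes R X M := by
  have h : Function.Injective
      (f.rTensor (FreeCover R M) ∘ₗ (relationModule R M).subtype.lTensor X) := by
    rw [LinearMap.rTensor_comp_lTensor, ← LinearMap.lTensor_comp_rTensor]
    exact Function.Injective.comp (g := (relationModule R M).subtype.lTensor Y) hY
      (hN.rTensor_injective hf hfg hg)
  exact Function.Injective.of_comp h

end

section

variable {A B M : Type*} [CommRing A] [CommRing B] [Algebra A B] [AddCommGroup M] [Module A M]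
  (P : Type*) [AddCommGroup P] [Module A P]

theorem flat_baseChange_relationModule [Module.Flat B (B ⊗[A] M)] (h : TorOneVanishes A B M) :
    Module.Flat B (B ⊗[A] relationModule A M) :=
  Module.Flat.of_exact (i := (relationModule A M).subtype.baseChange B)
    (p := (FreeCover.proj A M).baseChange B) h
    (lTensor_exact B (relationModule_exact A M) (FreeCover.proj_surjective A M))
    (LinearMap.lTensor_surjective B (FreeCover.proj_surjective A M))

theorem of_isScalarTower [Module B P] [IsScalarTower A B P]
    [Module.Flat B (B ⊗[A] M)] (h : TorOneVanishes A B M) : TorOneVanishes A P M := by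
  have h' : Function.Injective (((relationModule A M).subtype.baseChange B).lTensor P) :=
    LinearMap.lTensor_injective_of_flat_cokernel (i := (relationModule A M).subtype.baseChange B)
      (p := (FreeCover.proj A M).baseChange B) h
      (lTensor_exact B (relationModule_exact A M) (FreeCover.proj_surjective A M))
      (LinearMap.lTensor_surjective B (FreeCover.proj_surjective A M)) P
  let e₁ := AlgebraTensorModule.cancelBaseChange A B B P (relationModule A M)
  let e₂ := AlgebraTensorModule.cancelBaseChange A B B P (FreeCover A M)
  have h₂ : ∀ x, (relationModule A M).subtype.lTensor P (e₁ x) =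
      e₂ (((relationModule A M).subtype.baseChange B).lTensor P x) := fun x ↦
    (LinearMap.congr_fun (AlgebraTensorModule.lTensor_comp_cancelBaseChange A B B
      (relationModule A M).subtype) x)
  refine (Function.Injective.of_comp_iff' _ e₁.bijective).mp ?_
  intro x y hxy
  exact h' (e₂.injective (by rw [← h₂, ← h₂]; exact hxy))

theorem of_smul_eq_zero (hs : Function.Surjective (algebraMap A B))
    (hP : ∀ a : A, algebraMap A B a = 0 → ∀ x : P, a • x = 0)
    [Module.Flat B (B ⊗[A] M)] (h : TorOneVanishes A B M) : TorOneVanishes A P M := by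
  let φ : B →+* Module.End A P := (algebraMap A B).liftOfSurjective hs
    ⟨Module.toModuleEnd A (S := A) P, fun a ha ↦ LinearMap.ext (hP a ha)⟩
  have hφ (a : A) (x : P) : φ (algebraMap A B a) x = a • x := by
    have : φ (algebraMap A B a) = Module.toModuleEnd A (S := A) P a :=
      RingHom.liftOfRightInverse_comp_apply ..
    rw [this]; rfl
  let : Module B P := Module.compHom P φ
  have hsmul (b : B) (x : P) : b • x = φ b x := rfl
  have : IsScalarTower A B P := ⟨fun a b x ↦ by
    rw [Algebra.smul_def, mul_smul, hsmul, hφ]⟩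
  exact h.of_isScalarTower P

end

end TorOneVanishes

theorem Ideal.exists_linearEquiv_map {A B : Type*} [CommRing A] [CommRing B] [Algebra A B]
    (K : Ideal A) (hinj : ∀ k ∈ K, algebraMap A B k = 0 → k = 0)
    (hK : ∀ k ∈ K, ∀ x : B, ∃ k' ∈ K, algebraMap A B k' = x * algebraMap A B k) :
    ∃ e : K ≃ₗ[A] K.map (algebraMap A B), ∀ k, (e k : B) = algebraMap A B k := by
  let f : K →ₗ[A] K.map (algebraMap A B) :=
    ((Algebra.linearMap A B).restrictScalars A ∘ₗ K.subtype).codRestrict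
      ((K.map (algebraMap A B)).restrictScalars A) fun k ↦ Ideal.mem_map_of_mem _ k.2
  have hf (k : K) : (f k : B) = algebraMap A B k := rfl
  refine ⟨LinearEquiv.ofBijective f ⟨?_, ?_⟩, hf⟩
  · rw [injective_iff_map_eq_zero]
    intro k hk
    exact Subtype.ext (hinj k k.2 ((hf k).symm.trans (congrArg Subtype.val hk)))
  · rintro ⟨y, hy⟩
    suffices h : ∃ k ∈ K, algebraMap A B k = y by
      obtain ⟨k, hk, rfl⟩ := h
      exact ⟨⟨k, hk⟩, rfl⟩
    refine Submodule.span_induction ?_ ⟨0, K.zero_mem, map_zero _⟩ ?_ ?_ hy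
    · rintro _ ⟨k, hk, rfl⟩
      exact ⟨k, hk, rfl⟩
    · rintro _ _ _ _ ⟨k, hk, rfl⟩ ⟨l, hl, rfl⟩
      exact ⟨k + l, K.add_mem hk hl, map_add _ _ _⟩
    · rintro x _ _ ⟨k, hk, rfl⟩
      exact hK k hk x

/-- If an ideal `K` of `A` maps isomorphically onto an ideal of `B`, then `K ⊗ M → M` is injective
as soon as `M` becomes flat over `B`. -/
theorem Ideal.rTensor_subtype_injective {A B M : Type*} [CommRing A] [CommRing B] [Algebra A B]
    [AddCommGroup M] [Module A M] [Module.Flat B (B ⊗[A] M)]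
    (K : Ideal A) (hinj : ∀ k ∈ K, algebraMap A B k = 0 → k = 0)
    (hK : ∀ k ∈ K, ∀ x : B, ∃ k' ∈ K, algebraMap A B k' = x * algebraMap A B k) :
    Function.Injective (K.subtype.rTensor M) := by
  obtain ⟨e, he⟩ := K.exists_linearEquiv_map hinj hK
  let I := K.map (algebraMap A B)
  let c₁ := AlgebraTensorModule.cancelBaseChange A B B I M
  let c₂ := AlgebraTensorModule.cancelBaseChange A B B B M
  have hI : Function.Injective ((I.subtype.restrictScalars A).rTensor M) := by
    have h₂ (x) : (I.subtype.restrictScalars A).rTensor M (c₁ x) =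
        c₂ (I.subtype.rTensor (B ⊗[A] M) x) := by
      induction x with
      | zero => simp
      | add x y hx hy => simp only [map_add, hx, hy]
      | tmul i y =>
        induction y with
        | zero => simp
        | add x y hx hy => simp only [tmul_add, map_add, hx, hy]
        | tmul b m => rfl
    refine (Function.Injective.of_comp_iff' _ c₁.bijective).mp fun x y hxy ↦ ?_
    exact Module.Flat.rTensor_preserves_injective_linearMap (M := B ⊗[A] M) I.subtype
      I.subtype_injective (c₂.injective (by rw [← h₂, ← h₂]; exact hxy))
  have h : (Algebra.linearMap A B).rTensor M ∘ₗ K.subtype.rTensor M =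
      (I.subtype.restrictScalars A).rTensor M ∘ₗ (e.rTensor M).toLinearMap :=
    TensorProduct.ext' fun k m ↦ congrArg (· ⊗ₜ[A] m) (he k).symm
  have hcomp := hI.comp (e.rTensor M).injective
  exact Function.Injective.of_comp (f := (Algebra.linearMap A B).rTensor M)
    (by rw [← LinearMap.coe_comp, h]; exact hcomp)

/-- If an ideal `K` of `A` maps isomorphically onto an ideal of `B`, then `K` annihilates the kernel
of `N → B ⊗ N`. -/
theorem Ideal.smul_eq_zero_of_one_tmul_eq_zero {A B N : Type*} [CommRing A] [CommRing B]
    [Algebra A B] [AddCommGroup N] [Module A N]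
    (K : Ideal A) (hinj : ∀ k ∈ K, algebraMap A B k = 0 → k = 0)
    (hK : ∀ k ∈ K, ∀ x : B, ∃ k' ∈ K, algebraMap A B k' = x * algebraMap A B k)
    {k : A} (hk : k ∈ K) {n : N} (hn : (1 : B) ⊗ₜ[A] n = 0) : k • n = 0 := by
  obtain ⟨e, he⟩ := K.exists_linearEquiv_map hinj hK
  let μ : B →ₗ[A] A := K.subtype ∘ₗ e.symm.toLinearMap ∘ₗ
    (LinearMap.toSpanSingleton B (K.map (algebraMap A B)) (e ⟨k, hk⟩)).restrictScalars A
  have hμ : μ 1 = k := by simp [μ]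
  have h := congrArg ((TensorProduct.lid A N).toLinearMap ∘ₗ μ.rTensor N) hn
  simpa [hμ] using h

/-- Flatness can be checked on the two components of a Milnor square: here `A → A₂` is surjective
and its kernel maps isomorphically onto an ideal of `A₁`. -/
theorem Module.Flat.of_milnorSquare {A A₁ A₂ M : Type*} [CommRing A] [CommRing A₁] [CommRing A₂]
    [Algebra A A₁] [Algebra A A₂] [AddCommGroup M] [Module A M]
    (hs : Function.Surjective (algebraMap A A₂))
    (hinj : ∀ j : A, algebraMap A A₂ j = 0 → algebraMap A A₁ j = 0 → j = 0)
    (hJ : ∀ j : A, algebraMap A A₂ j = 0 → ∀ x : A₁,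
      ∃ j' : A, algebraMap A A₂ j' = 0 ∧ algebraMap A A₁ j' = x * algebraMap A A₁ j)
    [Module.Flat A₁ (A₁ ⊗[A] M)] [Module.Flat A₂ (A₂ ⊗[A] M)] : Module.Flat A M := by
  let J : Ideal A := RingHom.ker (algebraMap A A₂)
  let K : Ideal A := RingHom.ker (algebraMap A A₁)
  have hJA₂ : Function.Exact J.subtype (Algebra.linearMap A A₂) := fun x ↦
    ⟨fun hx ↦ ⟨⟨x, hx⟩, rfl⟩, by rintro ⟨y, rfl⟩; exact y.2⟩
  have hA₂ : TorOneVanishes A A₂ M := .of_rTensor_injective hJA₂ hs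
    (J.rTensor_subtype_injective (B := A₁) hinj hJ)
  let B : Submodule A A₁ := LinearMap.range (Algebra.linearMap A A₁)
  have hB : TorOneVanishes A B M := by
    refine .of_rTensor_injective (f := K.subtype) (g := (Algebra.linearMap A A₁).rangeRestrict)
      (fun x ↦ ⟨fun hx ↦ ⟨⟨x, congrArg Subtype.val hx⟩, rfl⟩, ?_⟩)
      (LinearMap.surjective_rangeRestrict _)
      (K.rTensor_subtype_injective (B := A₂) (fun k hk hk' ↦ hinj k hk' hk) fun k hk x ↦ ?_)
    · rintro ⟨y, rfl⟩
      exact Subtype.ext y.2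
    · obtain ⟨a, rfl⟩ := hs x
      exact ⟨a * k, K.mul_mem_left a hk, map_mul _ _ _⟩
  have hA₁ : TorOneVanishes A A₁ M := by
    refine .of_extension B.subtype_injective (LinearMap.exact_subtype_mkQ B) B.mkQ_surjective hB
      (hA₂.of_smul_eq_zero _ hs fun j hj x ↦ ?_)
    obtain ⟨x, rfl⟩ := B.mkQ_surjective x
    obtain ⟨j', -, hj'⟩ := hJ j hj x
    rw [← map_smul, Submodule.mkQ_apply, Submodule.Quotient.mk_eq_zero, Algebra.smul_def, mul_comm,
      ← hj']
    exact ⟨j', rfl⟩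
  have hA₂' : TorOneVanishes A A₂ (relationModule A M) := by
    obtain ⟨e, -⟩ := J.exists_linearEquiv_map (B := A₁) hinj hJ
    have hJM : TorOneVanishes A J M := (hA₁.of_isScalarTower _).congr e.symm
    refine .of_rTensor_injective hJA₂ hs ?_
    have h : Function.Injective (J.subtype.rTensor (FreeCover A M) ∘ₗ
        (relationModule A M).subtype.lTensor J) :=
      (Module.Flat.rTensor_preserves_injective_linearMap (M := FreeCover A M) J.subtype
        J.subtype_injective).comp hJM
    rw [LinearMap.rTensor_comp_lTensor, ← LinearMap.lTensor_comp_rTensor] at h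
    exact Function.Injective.of_comp h
  have := hA₂.flat_baseChange_relationModule
  have hN (N : Type _) [AddCommGroup N] [Module A N] : TorOneVanishes A N M := by
    let φ : N →ₗ[A] A₁ ⊗[A] N := TensorProduct.mk A A₁ N 1
    have hker : TorOneVanishes A (LinearMap.ker φ) M := by
      refine hA₂.of_smul_eq_zero _ hs fun j hj n ↦ Subtype.ext ?_
      exact J.smul_eq_zero_of_one_tmul_eq_zero hinj hJ hj n.2
    have hcoker : TorOneVanishes A ((A₁ ⊗[A] N) ⧸ LinearMap.range φ) (relationModule A M) := by
      refine hA₂'.of_smul_eq_zero _ hs fun j hj x ↦ ?_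
      obtain ⟨x, rfl⟩ := (LinearMap.range φ).mkQ_surjective x
      rw [← map_smul, Submodule.mkQ_apply, Submodule.Quotient.mk_eq_zero]
      induction x with
      | zero => simp
      | add x y hx hy => rw [smul_add]; exact add_mem hx hy
      | tmul b n =>
        obtain ⟨j', -, hj'⟩ := hJ j hj b
        refine ⟨j' • n, ?_⟩
        rw [map_smul, TensorProduct.mk_apply, smul_tmul', smul_tmul', Algebra.smul_def,
          Algebra.smul_def, mul_one, hj', mul_comm]
    have hrange : TorOneVanishes A (LinearMap.range φ) M :=
      .of_cokernel (LinearMap.range φ).subtype_injective (LinearMap.exact_subtype_mkQ _)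
        (LinearMap.range φ).mkQ_surjective (hA₁.of_isScalarTower _) hcoker
    exact .of_extension (LinearMap.ker φ).subtype_injective
      (g := φ.rangeRestrict)
      (by rw [LinearMap.exact_iff]; simp) φ.surjective_rangeRestrict hker hrange
  refine Module.Flat.iff_rTensor_injective'.mpr fun I ↦ ?_
  exact (hN (A ⧸ I)).rTensor_injective I.subtype_injective (LinearMap.exact_subtype_mkQ I)
    (Submodule.mkQ_surjective I)

theorem Module.FaithfullyFlat.of_milnorSquare {A A₁ A₂ M : Type*} [CommRing A] [CommRing A₁]
    [CommRing A₂] [Algebra A A₁] [Algebra A A₂] [AddCommGroup M] [Module A M]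
    (hs : Function.Surjective (algebraMap A A₂))
    (hinj : ∀ j : A, algebraMap A A₂ j = 0 → algebraMap A A₁ j = 0 → j = 0)
    (hJ : ∀ j : A, algebraMap A A₂ j = 0 → ∀ x : A₁,
      ∃ j' : A, algebraMap A A₂ j' = 0 ∧ algebraMap A A₁ j' = x * algebraMap A A₁ j)
    [Module.FaithfullyFlat A₁ (A₁ ⊗[A] M)] [Module.FaithfullyFlat A₂ (A₂ ⊗[A] M)] :
    Module.FaithfullyFlat A M := by
  refine (Module.FaithfullyFlat.iff_flat_and_rTensor_reflects_triviality A M).mpr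
    ⟨.of_milnorSquare hs hinj hJ, fun N _ _ hNM ↦ ?_⟩
  have h₁ : Subsingleton (A₁ ⊗[A] N) :=
    Module.FaithfullyFlat.rTensor_reflects_triviality A₁ (A₁ ⊗[A] M) _ (h :=
      (AlgebraTensorModule.distribBaseChange A A₁ N M).symm.toEquiv.subsingleton)
  have h₂ : Subsingleton (A₂ ⊗[A] N) :=
    Module.FaithfullyFlat.rTensor_reflects_triviality A₂ (A₂ ⊗[A] M) _ (h :=
      (AlgebraTensorModule.distribBaseChange A A₂ N M).symm.toEquiv.subsingleton)
  let J : Ideal A := RingHom.ker (algebraMap A A₂)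
  have hJN : (TensorProduct.lid A N).toLinearMap ∘ₗ J.subtype.rTensor N = 0 :=
    TensorProduct.ext' fun j n ↦ J.smul_eq_zero_of_one_tmul_eq_zero (B := A₁) hinj hJ j.2
      (Subsingleton.elim _ _)
  refine subsingleton_of_forall_eq 0 fun n ↦ ?_
  have hexact : Function.Exact J.subtype (Algebra.linearMap A A₂) := fun x ↦
    ⟨fun hx ↦ ⟨⟨x, hx⟩, rfl⟩, by rintro ⟨y, rfl⟩; exact y.2⟩
  obtain ⟨t, ht⟩ := (rTensor_exact N hexact hs (1 ⊗ₜ n)).mp (Subsingleton.elim _ _)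
  simpa [ht] using LinearMap.congr_fun hJN t

theorem IsBaseChange.mem_smul_top_of_map_eq_zero {R S M N : Type*} [CommRing R] [CommRing S]
    [Algebra R S] [AddCommGroup M] [AddCommGroup N] [Module R M] [Module R N] [Module S N]
    [IsScalarTower R S N] {f : M →ₗ[R] N} (hf : IsBaseChange S f)
    (hs : Function.Surjective (algebraMap R S)) {m : M} (hm : f m = 0) :
    m ∈ RingHom.ker (algebraMap R S) • (⊤ : Submodule R M) := by
  let I := RingHom.ker (algebraMap R S)
  have hexact : Function.Exact I.subtype (Algebra.linearMap R S) := fun x ↦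
    ⟨fun hx ↦ ⟨⟨x, hx⟩, rfl⟩, by rintro ⟨y, rfl⟩; exact y.2⟩
  have hm' : (Algebra.linearMap R S).rTensor M (1 ⊗ₜ m) = 0 := by
    apply hf.equiv.injective
    simp [hf.equiv_tmul, hm]
  obtain ⟨t, ht⟩ := (rTensor_exact M hexact hs _).mp hm'
  have h (t) : TensorProduct.lid R M (I.subtype.rTensor M t) ∈ I • (⊤ : Submodule R M) := by
    induction t with
    | zero => simp
    | add x y hx hy => simpa only [map_add] using add_mem hx hy
    | tmul i y => exact Submodule.smul_mem_smul i.2 Submodule.mem_top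
  simpa [ht] using h t

section FiberSquare

variable {A A₁ A₂ A₃ A' A₁' A₂' A₃' : Type*}
  [CommRing A] [CommRing A₁] [CommRing A₂] [CommRing A₃]
  [CommRing A'] [CommRing A₁'] [CommRing A₂'] [CommRing A₃']
  [Algebra A A₁] [Algebra A A₂] [Algebra A₁ A₃] [Algebra A₂ A₃]
  [Algebra A' A₁'] [Algebra A' A₂'] [Algebra A₁' A₃'] [Algebra A₂' A₃']
  [Algebra A A'] [Algebra A₁ A₁'] [Algebra A₂ A₂'] [Algebra A₃ A₃']
  [Algebra A A₁'] [IsScalarTower A A₁ A₁'] [IsScalarTower A A' A₁']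
  [Algebra A A₂'] [IsScalarTower A A₂ A₂'] [IsScalarTower A A' A₂']
  [Algebra A₁ A₃'] [IsScalarTower A₁ A₃ A₃'] [IsScalarTower A₁ A₁' A₃']
  [Algebra A₂ A₃'] [IsScalarTower A₂ A₃ A₃'] [IsScalarTower A₂ A₂' A₃']

theorem span_range_algebraMap_eq_top_of_fiberSquare
    (ht : Function.Surjective (algebraMap A₁ A₃))
    (ht' : Function.Surjective (algebraMap A₁' A₃'))
    (hex' : ∀ (x : A₁') (y : A₂'), algebraMap A₁' A₃' x = algebraMap A₂' A₃' y →
      ∃ a : A', algebraMap A' A₁' a = x ∧ algebraMap A' A₂' a = y)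
    [Algebra.IsPushout A₂ A₃ A₂' A₃'] :
    Submodule.span A₁ (Set.range (algebraMap A' A₁')) = ⊤ := by
  have h (z : A₃') : ∃ s ∈ Submodule.span A₁ (Set.range (algebraMap A' A₁')),
      algebraMap A₁' A₃' s = z := by
    induction z using (Algebra.IsPushout.out (R := A₂) (S := A₃) (R' := A₂')
      (S' := A₃')).inductionOn with
    | zero => exact ⟨0, zero_mem _, map_zero _⟩
    | tmul y =>
      obtain ⟨x, hx⟩ := ht' (algebraMap A₂' A₃' y)
      obtain ⟨a, rfl, rfl⟩ := hex' x y hx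
      exact ⟨_, Submodule.subset_span ⟨a, rfl⟩, hx⟩
    | smul c z hz =>
      obtain ⟨s, hs, rfl⟩ := hz
      obtain ⟨c, rfl⟩ := ht c
      refine ⟨c • s, Submodule.smul_mem _ _ hs, ?_⟩
      rw [algebraMap_smul, Algebra.smul_def, map_mul, Algebra.smul_def,
        ← IsScalarTower.algebraMap_apply]
    | add z w hz hw =>
      obtain ⟨s, hs, rfl⟩ := hz
      obtain ⟨t, ht, rfl⟩ := hw
      exact ⟨s + t, add_mem hs ht, map_add _ _ _⟩
  refine eq_top_iff.mpr fun x _ ↦ ?_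
  obtain ⟨s, hs, hsx⟩ := h (algebraMap A₁' A₃' x)
  obtain ⟨a, ha, -⟩ := hex' (x - s) 0 (by rw [map_sub, hsx, sub_self, map_zero])
  rw [← sub_add_cancel x s]
  exact add_mem (Submodule.subset_span ⟨a, ha⟩) hs

theorem isBaseChange_snd_of_fiberSquare
    (ht : Function.Surjective (algebraMap A₁ A₃))
    (ht' : Function.Surjective (algebraMap A₁' A₃'))
    (hs : Function.Surjective (algebraMap A A₂))
    (hex : ∀ (x : A₁) (y : A₂), algebraMap A₁ A₃ x = algebraMap A₂ A₃ y →
      ∃ a : A, algebraMap A A₁ a = x ∧ algebraMap A A₂ a = y)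
    (hcomm' : ∀ a : A', algebraMap A₁' A₃' (algebraMap A' A₁' a) =
      algebraMap A₂' A₃' (algebraMap A' A₂' a))
    (hinj' : ∀ a : A', algebraMap A' A₁' a = 0 → algebraMap A' A₂' a = 0 → a = 0)
    (hex' : ∀ (x : A₁') (y : A₂'), algebraMap A₁' A₃' x = algebraMap A₂' A₃' y →
      ∃ a : A', algebraMap A' A₁' a = x ∧ algebraMap A' A₂' a = y)
    [Algebra.IsPushout A₁ A₃ A₁' A₃'] [Algebra.IsPushout A₂ A₃ A₂' A₃'] :
    IsBaseChange A₂ (IsScalarTower.toAlgHom A A' A₂').toLinearMap := by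
  let f : A₂ ⊗[A] A' →ₗ[A₂] A₂' :=
    (IsScalarTower.toAlgHom A A' A₂').toLinearMap.liftBaseChange A₂
  have hf (m : A') : f (1 ⊗ₜ m) = algebraMap A' A₂' m := by simp [f]
  refine IsBaseChange.of_equiv (LinearEquiv.ofBijective f ⟨?_, fun y ↦ ?_⟩) hf
  · rw [injective_iff_map_eq_zero]
    intro t ht₀
    obtain ⟨m, rfl⟩ := TensorProduct.mk_surjective A A' A₂ hs t
    rw [TensorProduct.mk_apply, hf] at ht₀
    have hlift (z) (hz : z ∈ Submodule.span A₁ (Set.range (algebraMap A' A₁'))) :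
        ∀ i : A₁, algebraMap A₁ A₃ i = 0 → ∃ b : A', (1 : A₂) ⊗ₜ[A] b = 0 ∧
          algebraMap A' A₁' b = i • z := by
      induction hz using Submodule.span_induction with
      | mem z hz =>
        obtain ⟨c, rfl⟩ := hz
        intro i hi
        obtain ⟨j, rfl, hj⟩ := hex i 0 (by rw [hi, map_zero])
        refine ⟨j • c, ?_, ?_⟩
        · rw [← smul_tmul, Algebra.smul_def, hj, zero_mul, zero_tmul]
        · rw [algebraMap_smul, Algebra.smul_def, map_mul, Algebra.smul_def,
            ← IsScalarTower.algebraMap_apply]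
      | zero => exact fun i _ ↦ ⟨0, tmul_zero _ _, by simp⟩
      | add z w _ _ hz hw =>
        intro i hi
        obtain ⟨b, hb, hb'⟩ := hz i hi
        obtain ⟨c, hc, hc'⟩ := hw i hi
        exact ⟨b + c, by rw [tmul_add, hb, hc, add_zero], by rw [map_add, hb', hc', smul_add]⟩
      | smul a z _ hz =>
        intro i hi
        rw [← mul_smul]
        exact hz _ (by rw [map_mul, hi, zero_mul])
    have hker (z) (hz : z ∈ RingHom.ker (algebraMap A₁ A₃) • (⊤ : Submodule A₁ A₁')) :
        ∃ b : A', (1 : A₂) ⊗ₜ[A] b = 0 ∧ algebraMap A' A₁' b = z := by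
      induction hz using Submodule.smul_induction_on' with
      | smul i hi z _ =>
        exact hlift z (by
          rw [span_range_algebraMap_eq_top_of_fiberSquare (A₂ := A₂) ht ht' hex']; trivial) i hi
      | add z _ w _ hz hw =>
        obtain ⟨b, hb, rfl⟩ := hz
        obtain ⟨c, hc, rfl⟩ := hw
        exact ⟨b + c, by rw [tmul_add, hb, hc, add_zero], map_add _ _ _⟩
    have hm : algebraMap A₁' A₃' (algebraMap A' A₁' m) = 0 := by rw [hcomm', ht₀, map_zero]
    obtain ⟨j, hj, hjm⟩ := hker _ ((Algebra.IsPushout.out (R := A₁) (S := A₃) (R' := A₁')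
      (S' := A₃')).mem_smul_top_of_map_eq_zero ht hm)
    have hj' : algebraMap A' A₂' j = 0 := by rw [← hf, hj, map_zero]
    have hmj : m = j := sub_eq_zero.mp <|
      hinj' _ (by rw [map_sub, hjm, sub_self]) (by rw [map_sub, hj', ht₀, sub_self])
    rw [TensorProduct.mk_apply, hmj, hj]
  · obtain ⟨x, hx⟩ := ht' (algebraMap A₂' A₃' y)
    obtain ⟨a, -, rfl⟩ := hex' x y hx
    exact ⟨1 ⊗ₜ a, hf a⟩

theorem isBaseChange_fst_of_fiberSquare
    (ht : Function.Surjective (algebraMap A₁ A₃))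
    (ht' : Function.Surjective (algebraMap A₁' A₃'))
    (hex : ∀ (x : A₁) (y : A₂), algebraMap A₁ A₃ x = algebraMap A₂ A₃ y →
      ∃ a : A, algebraMap A A₁ a = x ∧ algebraMap A A₂ a = y)
    (hcomm : ∀ a : A, algebraMap A₁ A₃ (algebraMap A A₁ a) =
      algebraMap A₂ A₃ (algebraMap A A₂ a))
    (hcomm' : ∀ a : A', algebraMap A₁' A₃' (algebraMap A' A₁' a) =
      algebraMap A₂' A₃' (algebraMap A' A₂' a))
    (hinj' : ∀ a : A', algebraMap A' A₁' a = 0 → algebraMap A' A₂' a = 0 → a = 0)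
    (hex' : ∀ (x : A₁') (y : A₂'), algebraMap A₁' A₃' x = algebraMap A₂' A₃' y →
      ∃ a : A', algebraMap A' A₁' a = x ∧ algebraMap A' A₂' a = y)
    [Algebra.IsPushout A₂ A₃ A₂' A₃']
    (h₂ : IsBaseChange A₂ (IsScalarTower.toAlgHom A A' A₂').toLinearMap) :
    IsBaseChange A₁ (IsScalarTower.toAlgHom A A' A₁').toLinearMap := by
  let f : A₁ ⊗[A] A' →ₗ[A₁] A₁' :=
    (IsScalarTower.toAlgHom A A' A₁').toLinearMap.liftBaseChange A₁
  have hf (m : A') : f (1 ⊗ₜ m) = algebraMap A' A₁' m := by simp [f]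
  refine IsBaseChange.of_equiv (LinearEquiv.ofBijective f ⟨?_, ?_⟩) hf
  · let : Algebra A A₃ := ((algebraMap A₁ A₃).comp (algebraMap A A₁)).toAlgebra
    let : Algebra A A₃' := ((algebraMap A₁ A₃').comp (algebraMap A A₁)).toAlgebra
    have : IsScalarTower A A₁ A₃ := .of_algebraMap_eq fun _ ↦ rfl
    have : IsScalarTower A A₂ A₃ := .of_algebraMap_eq hcomm
    have : IsScalarTower A A₁ A₃' := .of_algebraMap_eq fun _ ↦ rfl
    have : IsScalarTower A A₂ A₃' := .of_algebraMap_eq fun a ↦ by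
      rw [IsScalarTower.algebraMap_apply A A₁ A₃', IsScalarTower.algebraMap_apply A₁ A₃ A₃', hcomm,
        ← IsScalarTower.algebraMap_apply A₂ A₃ A₃']
    have : IsScalarTower A A₃ A₃' := .of_algebraMap_eq fun a ↦ by
      rw [IsScalarTower.algebraMap_apply A A₁ A₃', IsScalarTower.algebraMap_apply A₁ A₃ A₃']; rfl
    let g : A₁ ⊗[A] A' →ₗ[A₁] A₃' := (IsScalarTower.toAlgHom A₁ A₁' A₃').toLinearMap ∘ₗ f
    have hg : IsBaseChange A₃ g := by
      refine IsBaseChange.of_comp (TensorProduct.isBaseChange A A' A₁) ?_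
      convert h₂.comp (Algebra.IsPushout.out (R := A₂) (S := A₃) (R' := A₂') (S' := A₃')) using 1
      ext m
      simpa [g, hf] using hcomm' m
    have hker (x) (hx : x ∈ RingHom.ker (algebraMap A₁ A₃) • (⊤ : Submodule A₁ (A₁ ⊗[A] A'))) :
        ∃ m : A', algebraMap A' A₂' m = 0 ∧ 1 ⊗ₜ m = x := by
      induction hx using Submodule.smul_induction_on' with
      | smul i hi x _ =>
        induction x with
        | zero => exact ⟨0, map_zero _, by simp⟩
        | add x y hx hy =>
          obtain ⟨m, hm, hm'⟩ := hx trivial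
          obtain ⟨n, hn, hn'⟩ := hy trivial
          exact ⟨m + n, by rw [map_add, hm, hn, add_zero], by rw [tmul_add, hm', hn', smul_add]⟩
        | tmul a m =>
          obtain ⟨j, hj, hj'⟩ := hex (i * a) 0
            (by rw [map_mul, (RingHom.mem_ker).mp hi, zero_mul, map_zero])
          refine ⟨j • m, ?_, ?_⟩
          · rw [Algebra.smul_def, map_mul, ← IsScalarTower.algebraMap_apply,
              IsScalarTower.algebraMap_apply A A₂ A₂', hj', map_zero, zero_mul]
          · rw [← smul_tmul, Algebra.smul_def, hj, mul_one, smul_tmul', smul_eq_mul]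
      | add x _ y _ hx hy =>
        obtain ⟨m, hm, rfl⟩ := hx
        obtain ⟨n, hn, rfl⟩ := hy
        exact ⟨m + n, by rw [map_add, hm, hn, add_zero], tmul_add _ _ _⟩
    rw [injective_iff_map_eq_zero]
    intro x hx
    obtain ⟨m, hm, rfl⟩ := hker x
      (hg.mem_smul_top_of_map_eq_zero ht (by rw [LinearMap.comp_apply, hx, map_zero]))
    rw [hf] at hx
    rw [hinj' m hx hm, tmul_zero]
  · rw [← LinearMap.range_eq_top, eq_top_iff,
      ← span_range_algebraMap_eq_top_of_fiberSquare (A₂ := A₂) ht ht' hex', Submodule.span_le]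
    rintro _ ⟨m, rfl⟩
    exact ⟨1 ⊗ₜ m, hf m⟩

/-- In a fiber square of rings with `A₁ → A₃` surjective, faithful flatness of the vertices
`A₁ → A₁'` and `A₂ → A₂'` of a cocartesian map of squares implies that of `A → A'`. -/
theorem Module.FaithfullyFlat.of_fiberSquare
    (ht : Function.Surjective (algebraMap A₁ A₃))
    (hcomm : ∀ a : A, algebraMap A₁ A₃ (algebraMap A A₁ a) =
      algebraMap A₂ A₃ (algebraMap A A₂ a))
    (hinj : ∀ a : A, algebraMap A A₁ a = 0 → algebraMap A A₂ a = 0 → a = 0)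
    (hex : ∀ (x : A₁) (y : A₂), algebraMap A₁ A₃ x = algebraMap A₂ A₃ y →
      ∃ a : A, algebraMap A A₁ a = x ∧ algebraMap A A₂ a = y)
    (hcomm' : ∀ a : A', algebraMap A₁' A₃' (algebraMap A' A₁' a) =
      algebraMap A₂' A₃' (algebraMap A' A₂' a))
    (hinj' : ∀ a : A', algebraMap A' A₁' a = 0 → algebraMap A' A₂' a = 0 → a = 0)
    (hex' : ∀ (x : A₁') (y : A₂'), algebraMap A₁' A₃' x = algebraMap A₂' A₃' y →
      ∃ a : A', algebraMap A' A₁' a = x ∧ algebraMap A' A₂' a = y)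
    [Algebra.IsPushout A₁ A₃ A₁' A₃'] [Algebra.IsPushout A₂ A₃ A₂' A₃']
    [Module.FaithfullyFlat A₁ A₁'] [Module.FaithfullyFlat A₂ A₂'] :
    Module.FaithfullyFlat A A' := by
  have ht' : Function.Surjective (algebraMap A₁' A₃') := fun z ↦ by
    induction z using (Algebra.IsPushout.out (R := A₁) (S := A₃) (R' := A₁')
      (S' := A₃')).inductionOn with
    | zero => exact ⟨0, map_zero _⟩
    | tmul y => exact ⟨y, rfl⟩
    | smul c z hz =>
      obtain ⟨x, rfl⟩ := hz
      obtain ⟨c, rfl⟩ := ht c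
      refine ⟨c • x, ?_⟩
      rw [algebraMap_smul, Algebra.smul_def, map_mul, Algebra.smul_def,
        ← IsScalarTower.algebraMap_apply]
    | add z w hz hw =>
      obtain ⟨x, rfl⟩ := hz
      obtain ⟨y, rfl⟩ := hw
      exact ⟨x + y, map_add _ _ _⟩
  have hs : Function.Surjective (algebraMap A A₂) := fun y ↦ by
    obtain ⟨x, hx⟩ := ht (algebraMap A₂ A₃ y)
    obtain ⟨a, -, ha⟩ := hex x y hx
    exact ⟨a, ha⟩
  have h₂ := isBaseChange_snd_of_fiberSquare ht ht' hs hex hcomm' hinj' hex'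
  have h₁ := isBaseChange_fst_of_fiberSquare ht ht' hex hcomm hcomm' hinj' hex' h₂
  have : Module.FaithfullyFlat A₁ (A₁ ⊗[A] A') := .of_linearEquiv A₁ _ h₁.equiv
  have : Module.FaithfullyFlat A₂ (A₂ ⊗[A] A') := .of_linearEquiv A₂ _ h₂.equiv
  refine .of_milnorSquare (A₁ := A₁) hs (fun j h h' ↦ hinj j h' h) fun j hj x ↦ ?_
  obtain ⟨j', hj', hj''⟩ := hex (x * algebraMap A A₁ j) 0
    (by rw [map_mul, hcomm, hj, map_zero, mul_zero])
  exact ⟨j', hj'', hj'⟩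

end FiberSquare

end

section

variable (A1 A2 A3 A1' A2' A3' : Type*)
  [CommRing A1] [CommRing A2] [CommRing A3]
  [CommRing A1'] [CommRing A2'] [CommRing A3']
  [Algebra A1 A3] [Algebra A2 A3]
  [Algebra A1 A1'] [Algebra A2 A2'] [Algebra A3 A3']
  [Algebra A1' A3'] [Algebra A2' A3']
  [Algebra A1 A3'] [Algebra A2 A3']
  [IsScalarTower A1 A3 A3'] [IsScalarTower A1 A1' A3']
  [IsScalarTower A2 A3 A3'] [IsScalarTower A2 A2' A3']

/-- Let `[A₁ ← A₃ → A₂]` be a diagram of commutative rings with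
`A₁ → A₃` surjective. Given faithfully flat ring maps `gᵢ : Aᵢ → Aᵢ'`
compatible with base-change isomorphisms `A₃' ≅ A₃ ⊗_{A₁} A₁' ≅ A₃ ⊗_{A₂} A₂'`
(expressed as pushout squares), the induced map
`A₁ ×_{A₃} A₂ → A₁' ×_{A₃'} A₂'` is faithfully flat. -/
theorem ringFiberProdMap_faithfullyFlat
    (ht₁ : Function.Surjective (algebraMap A1 A3))
    [Module.FaithfullyFlat A1 A1'] [Module.FaithfullyFlat A2 A2']
    [Module.FaithfullyFlat A3 A3']
    [Algebra.IsPushout A1 A3 A1' A3'] [Algebra.IsPushout A2 A3 A2' A3'] :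
    letI : Algebra (ringFiberProd A1 A2 A3) (ringFiberProd A1' A2' A3') :=
      (ringFiberProdMap A1 A2 A3 A1' A2' A3').toAlgebra
    Module.FaithfullyFlat (ringFiberProd A1 A2 A3) (ringFiberProd A1' A2' A3') := by
  let : Algebra (ringFiberProd A1 A2 A3) (ringFiberProd A1' A2' A3') :=
    (ringFiberProdMap A1 A2 A3 A1' A2' A3').toAlgebra
  let φ₁ := (RingHom.fst A1 A2).comp (ringFiberProd A1 A2 A3).subtype
  let φ₂ := (RingHom.snd A1 A2).comp (ringFiberProd A1 A2 A3).subtype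
  let : Algebra (ringFiberProd A1 A2 A3) A1 := φ₁.toAlgebra
  let : Algebra (ringFiberProd A1 A2 A3) A2 := φ₂.toAlgebra
  let : Algebra (ringFiberProd A1' A2' A3') A1' :=
    ((RingHom.fst A1' A2').comp (ringFiberProd A1' A2' A3').subtype).toAlgebra
  let : Algebra (ringFiberProd A1' A2' A3') A2' :=
    ((RingHom.snd A1' A2').comp (ringFiberProd A1' A2' A3').subtype).toAlgebra
  let : Algebra (ringFiberProd A1 A2 A3) A1' := ((algebraMap A1 A1').comp φ₁).toAlgebra
  let : Algebra (ringFiberProd A1 A2 A3) A2' := ((algebraMap A2 A2').comp φ₂).toAlgebra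
  have : IsScalarTower (ringFiberProd A1 A2 A3) A1 A1' := .of_algebraMap_eq fun _ ↦ rfl
  have : IsScalarTower (ringFiberProd A1 A2 A3) A2 A2' := .of_algebraMap_eq fun _ ↦ rfl
  have : IsScalarTower (ringFiberProd A1 A2 A3) (ringFiberProd A1' A2' A3') A1' :=
    .of_algebraMap_eq fun _ ↦ rfl
  have : IsScalarTower (ringFiberProd A1 A2 A3) (ringFiberProd A1' A2' A3') A2' :=
    .of_algebraMap_eq fun _ ↦ rfl
  exact .of_fiberSquare (A₃ := A3) (A₃' := A3') ht₁ (fun a ↦ a.2)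
    (fun a h h' ↦ Subtype.ext (Prod.ext h h')) (fun x y h ↦ ⟨⟨(x, y), h⟩, rfl, rfl⟩)
    (fun a ↦ a.2) (fun a h h' ↦ Subtype.ext (Prod.ext h h'))
    (fun x y h ↦ ⟨⟨(x, y), h⟩, rfl, rfl⟩)

end
end
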